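/- (Lemma 4.1) Let u, v be real-analytic functions on a neighborhood of the origin in ℝ² with ∂₁u + ∂₂v = 0 and u(0,0)·v(0,0) ≠ 0. Then there exist a neighborhood W of the origin and real-analytic functions p, g₁₁, g₁₂, g₂₂ on W with p > 0, g₁₁(0,0) = g₂₂(0,0) = 1, g₁₂(0,0) = 0, and det g := g₁₁g₂₂ − g₁₂² > 0, such that: (i) ∂₁₁(u²) + 2∂₁₂(uv) + ∂₂₂(v²) = −(∂₁₁p + ∂₂₂p) on W; and (ii) with L := v² + p, M := −uv, N := u² + p, the triple (L, M, N) together with the metric g satisfies the Gauss–Codazzi equations on W (Codazzi equations with the Christoffel symbols of g, and Gauss equation LN − M² = κ with κ the Brioschi curvature of g). -/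

import Mathlib

noncomputable def sd1 (f : ℝ × ℝ → ℝ) (x : ℝ × ℝ) : ℝ :=
  deriv (fun s => f (s, x.2)) x.1

noncomputable def sd2 (f : ℝ × ℝ → ℝ) (x : ℝ × ℝ) : ℝ :=
  deriv (fun s => f (x.1, s)) x.2

/-- Determinant of the metric `g₁₁g₂₂ - g₁₂²`. -/
noncomputable def sdetg (g11 g12 g22 : ℝ × ℝ → ℝ) (x : ℝ × ℝ) : ℝ :=
  g11 x * g22 x - (g12 x) ^ 2

/-- Christoffel symbol Γ¹₁₁. -/
noncomputable def sGamma1_11 (g11 g12 g22 : ℝ × ℝ → ℝ) (x : ℝ × ℝ) : ℝ :=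
  (g22 x * sd1 g11 x - g12 x * (2 * sd1 g12 x - sd2 g11 x)) / (2 * sdetg g11 g12 g22 x)

/-- Christoffel symbol Γ¹₁₂. -/
noncomputable def sGamma1_12 (g11 g12 g22 : ℝ × ℝ → ℝ) (x : ℝ × ℝ) : ℝ :=
  (g22 x * sd2 g11 x - g12 x * sd1 g22 x) / (2 * sdetg g11 g12 g22 x)

/-- Christoffel symbol Γ¹₂₂. -/
noncomputable def sGamma1_22 (g11 g12 g22 : ℝ × ℝ → ℝ) (x : ℝ × ℝ) : ℝ :=
  (g22 x * (2 * sd2 g12 x - sd1 g22 x) - g12 x * sd2 g22 x) / (2 * sdetg g11 g12 g22 x)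

/-- Christoffel symbol Γ²₁₁. -/
noncomputable def sGamma2_11 (g11 g12 g22 : ℝ × ℝ → ℝ) (x : ℝ × ℝ) : ℝ :=
  (-(g12 x) * sd1 g11 x + g11 x * (2 * sd1 g12 x - sd2 g11 x)) / (2 * sdetg g11 g12 g22 x)

/-- Christoffel symbol Γ²₁₂. -/
noncomputable def sGamma2_12 (g11 g12 g22 : ℝ × ℝ → ℝ) (x : ℝ × ℝ) : ℝ :=
  (-(g12 x) * sd2 g11 x + g11 x * sd1 g22 x) / (2 * sdetg g11 g12 g22 x)

/-- Christoffel symbol Γ²₂₂. -/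
noncomputable def sGamma2_22 (g11 g12 g22 : ℝ × ℝ → ℝ) (x : ℝ × ℝ) : ℝ :=
  (-(g12 x) * (2 * sd2 g12 x - sd1 g22 x) + g11 x * sd2 g22 x) / (2 * sdetg g11 g12 g22 x)

/-- Gauss curvature of `g` via the Brioschi formula. -/
noncomputable def sbrioschi (g11 g12 g22 : ℝ × ℝ → ℝ) (x : ℝ × ℝ) : ℝ :=
  (1 / (2 * (sdetg g11 g12 g22 x) ^ 2)) *
    Matrix.det !![-(sd2 (sd2 g11) x) + 2 * sd1 (sd2 g12) x - sd1 (sd1 g22) x,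
                    sd1 g11 x, 2 * sd1 g12 x - sd2 g11 x;
                  2 * sd2 g12 x - sd1 g22 x, 2 * g11 x, 2 * g12 x;
                  sd2 g22 x, 2 * g12 x, 2 * g22 x]
  - (1 / (2 * (sdetg g11 g12 g22 x) ^ 2)) *
    Matrix.det !![0, sd2 g11 x, sd1 g22 x;
                  sd2 g11 x, 2 * g11 x, 2 * g12 x;
                  sd1 g22 x, 2 * g12 x, 2 * g22 x]

/-- The Gauss–Codazzi equations for `(L, M, N)` and the metric `g` at the point `x`. -/
def SGaussCodazzi (L M N g11 g12 g22 : ℝ × ℝ → ℝ) (x : ℝ × ℝ) : Prop :=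
  sd1 N x - sd2 M x =
    -(sGamma1_22 g11 g12 g22 x) * L x + 2 * sGamma1_12 g11 g12 g22 x * M x
      - sGamma1_11 g11 g12 g22 x * N x ∧
  sd1 M x - sd2 L x =
    sGamma2_22 g11 g12 g22 x * L x - 2 * sGamma2_12 g11 g12 g22 x * M x
      + sGamma2_11 g11 g12 g22 x * N x ∧
  L x * N x - (M x) ^ 2 = sbrioschi g11 g12 g22 x


abbrev Ix := Fin 2 →₀ ℕ

/-- The weight `1 / binom(m+n, m)`. -/
noncomputable def wt (d : Ix) : ℝ := ((d 0 + d 1).choose (d 0) : ℝ)⁻¹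

lemma choose_pos' (d : Ix) : 0 < ((d 0 + d 1).choose (d 0) : ℝ) := by
  exact_mod_cast Nat.choose_pos (Nat.le_add_right _ _)

lemma wt_pos (d : Ix) : 0 < wt d := inv_pos.2 (choose_pos' d)

lemma wt_le_one (d : Ix) : wt d ≤ 1 := by
  apply inv_le_one_of_one_le₀
  exact_mod_cast Nat.choose_pos (Nat.le_add_right _ _)

lemma wt_zero : wt 0 = 1 := by simp [wt]

lemma half_pow_le_wt (d : Ix) : (1 / 2 : ℝ) ^ (d 0 + d 1) ≤ wt d := by
  rw [wt, one_div, inv_pow]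
  apply inv_anti₀ (choose_pos' d)
  exact_mod_cast Nat.choose_le_two_pow _ _

lemma wt_add (a b : Ix) : wt (a + b) ≤ wt a * wt b := by
  simp only [wt, Finsupp.add_apply]
  rw [← mul_inv]
  apply inv_anti₀ (mul_pos (choose_pos' a) (choose_pos' b))
  have h := Nat.add_choose_eq (a 0 + a 1) (b 0 + b 1) (a 0 + b 0)
  have h2 : a 0 + b 0 + (a 1 + b 1) = a 0 + a 1 + (b 0 + b 1) := by ring
  rw [h2, h]
  have := Finset.single_le_sum
    (f := fun ij : ℕ × ℕ => (a 0 + a 1).choose ij.1 * (b 0 + b 1).choose ij.2)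
    (s := Finset.HasAntidiagonal.antidiagonal (a 0 + b 0)) (fun _ _ => Nat.zero_le _)
    (a := (a 0, b 0)) (by simp)
  exact_mod_cast this

/-- weighted absolute summability of the coefficients -/
def WS (f : MvPowerSeries (Fin 2) ℝ) : Prop :=
  Summable fun d : Ix => |MvPowerSeries.coeff d f| * wt d

noncomputable def wnorm (f : MvPowerSeries (Fin 2) ℝ) : ℝ :=
  ∑' d : Ix, |MvPowerSeries.coeff d f| * wt d

lemma term_nonneg (f : MvPowerSeries (Fin 2) ℝ) (d : Ix) :
    0 ≤ |MvPowerSeries.coeff d f| * wt d := mul_nonneg (abs_nonneg _) (wt_pos d).le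

lemma WS.mul_aux {f g : MvPowerSeries (Fin 2) ℝ} (hf : WS f) (hg : WS g) :
    WS (f * g) ∧ wnorm (f * g) ≤ wnorm f * wnorm g := by
  have hs : Summable fun x : Ix × Ix => (|MvPowerSeries.coeff x.1 f| * wt x.1) *
        (|MvPowerSeries.coeff x.2 g| * wt x.2) :=
    Summable.mul_of_nonneg (f := fun d : Ix => |MvPowerSeries.coeff d f| * wt d)
      (g := fun d : Ix => |MvPowerSeries.coeff d g| * wt d) hf hg (term_nonneg f) (term_nonneg g)
  have hs2 := summable_sum_mul_antidiagonal_of_summable_mul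
      (f := fun d : Ix => |MvPowerSeries.coeff d f| * wt d)
      (g := fun d : Ix => |MvPowerSeries.coeff d g| * wt d) hs
  have hle : ∀ d : Ix, |MvPowerSeries.coeff d (f * g)| * wt d ≤
      ∑ kl ∈ Finset.HasAntidiagonal.antidiagonal d, (|MvPowerSeries.coeff kl.1 f| * wt kl.1) *
        (|MvPowerSeries.coeff kl.2 g| * wt kl.2) := by
    intro d
    rw [MvPowerSeries.coeff_mul]
    calc _ ≤ (∑ kl ∈ Finset.HasAntidiagonal.antidiagonal d, |MvPowerSeries.coeff kl.1 f *
            MvPowerSeries.coeff kl.2 g|) * wt d :=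
          mul_le_mul_of_nonneg_right (Finset.abs_sum_le_sum_abs _ _) (wt_pos d).le
      _ = ∑ kl ∈ Finset.HasAntidiagonal.antidiagonal d, |MvPowerSeries.coeff kl.1 f *
            MvPowerSeries.coeff kl.2 g| * wt d := Finset.sum_mul _ _ _
      _ ≤ _ := by
          apply Finset.sum_le_sum
          intro kl hkl
          rw [Finset.HasAntidiagonal.mem_antidiagonal] at hkl
          rw [abs_mul, ← hkl]
          calc _ ≤ |MvPowerSeries.coeff kl.1 f| * |MvPowerSeries.coeff kl.2 g| *
                (wt kl.1 * wt kl.2) :=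
              mul_le_mul_of_nonneg_left (wt_add _ _) (by positivity)
            _ = _ := by ring
  have hWS : WS (f * g) := Summable.of_nonneg_of_le (term_nonneg _) hle hs2
  refine ⟨hWS, ?_⟩
  unfold wnorm
  rw [Summable.tsum_mul_tsum_eq_tsum_sum_antidiagonal
      (f := fun d : Ix => |MvPowerSeries.coeff d f| * wt d)
      (g := fun d : Ix => |MvPowerSeries.coeff d g| * wt d) hf hg hs]
  exact Summable.tsum_le_tsum hle hWS hs2

lemma WS.add_aux {f g : MvPowerSeries (Fin 2) ℝ} (hf : WS f) (hg : WS g) :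
    WS (f + g) ∧ wnorm (f + g) ≤ wnorm f + wnorm g := by
  have hs := hf.add hg
  have hle : ∀ d : Ix, |MvPowerSeries.coeff d (f + g)| * wt d ≤
      |MvPowerSeries.coeff d f| * wt d + |MvPowerSeries.coeff d g| * wt d := by
    intro d
    rw [map_add, ← add_mul]
    exact mul_le_mul_of_nonneg_right (abs_add_le _ _) (wt_pos d).le
  have hWS : WS (f + g) := Summable.of_nonneg_of_le (term_nonneg _) hle hs
  refine ⟨hWS, ?_⟩
  unfold wnorm
  rw [← hf.tsum_add hg]
  exact hWS.tsum_le_tsum hle hs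

lemma WS.algebraMap (r : ℝ) : WS (algebraMap ℝ _ r) := by
  apply summable_of_ne_finset_zero (s := {0})
  intro d hd
  rw [Finset.mem_singleton] at hd
  rw [MvPowerSeries.algebraMap_apply, MvPowerSeries.coeff_C]
  simp [hd]

def PSA : Subalgebra ℝ (MvPowerSeries (Fin 2) ℝ) where
  carrier := {f | WS f}
  mul_mem' hf hg := (WS.mul_aux hf hg).1
  add_mem' hf hg := (WS.add_aux hf hg).1
  algebraMap_mem' r := WS.algebraMap r

/-- The algebra of weighted-summable power series in two variables. -/
def PA : Type := ↥PSA

noncomputable instance : CommRing PA := inferInstanceAs (CommRing ↥PSA)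
noncomputable instance : Algebra ℝ PA := inferInstanceAs (Algebra ℝ ↥PSA)

namespace PA

/-- coefficient -/
noncomputable def cf (f : PA) (d : Ix) : ℝ := MvPowerSeries.coeff d f.1

lemma ext' {f g : PA} (h : ∀ d, f.cf d = g.cf d) : f = g :=
  Subtype.ext (MvPowerSeries.ext h)

lemma cf_add (f g : PA) (d : Ix) : (f + g).cf d = f.cf d + g.cf d := rfl
lemma cf_zero (d : Ix) : (0 : PA).cf d = 0 := rfl
lemma cf_smul (c : ℝ) (f : PA) (d : Ix) : (c • f).cf d = c * f.cf d := rfl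
lemma cf_sub (f g : PA) (d : Ix) : (f - g).cf d = f.cf d - g.cf d := rfl
lemma cf_mul (f g : PA) (d : Ix) :
    (f * g).cf d = ∑ kl ∈ Finset.HasAntidiagonal.antidiagonal d, f.cf kl.1 * g.cf kl.2 :=
  MvPowerSeries.coeff_mul d f.1 g.1
lemma cf_algebraMap (r : ℝ) (d : Ix) : (algebraMap ℝ PA r).cf d = if d = 0 then r else 0 := by
  show MvPowerSeries.coeff d (algebraMap ℝ _ r) = _
  rw [MvPowerSeries.algebraMap_apply, MvPowerSeries.coeff_C]
  simp

lemma summable (f : PA) : Summable fun d => |f.cf d| * wt d := f.2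

noncomputable instance : Norm PA := ⟨fun f => wnorm f.1⟩

lemma norm_def (f : PA) : ‖f‖ = ∑' d, |f.cf d| * wt d := rfl

lemma term_le (f : PA) (d : Ix) : |f.cf d| * wt d ≤ ‖f‖ :=
  f.summable.le_tsum d (fun _ _ => term_nonneg _ _)

/-- constructor from coefficients -/
def mk (c : Ix → ℝ) (h : Summable fun d => |c d| * wt d) : PA := ⟨c, h⟩

lemma cf_mk (c : Ix → ℝ) (h : Summable fun d => |c d| * wt d) (d : Ix) : (mk c h).cf d = c d := rfl

lemma core : NormedSpace.Core ℝ PA where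
  norm_nonneg f := tsum_nonneg (fun _ => term_nonneg _ _)
  norm_smul c f := by
    rw [norm_def, norm_def, ← tsum_mul_left]
    congr 1
    ext d
    rw [cf_smul, abs_mul, Real.norm_eq_abs, mul_assoc]
  norm_triangle f g := (WS.add_aux f.2 g.2).2
  norm_eq_zero_iff f := by
    constructor
    · intro h
      apply ext'
      intro d
      have := term_le f d
      rw [h] at this
      have h3 : |f.cf d| ≤ 0 := by
        by_contra hc
        push Not at hc
        exact absurd (mul_pos hc (wt_pos d)) (not_lt.2 this)
      rw [cf_zero]
      exact abs_nonpos_iff.1 h3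
    · rintro rfl
      simp [norm_def, cf_zero]

noncomputable instance instNACG : NormedAddCommGroup PA := NormedAddCommGroup.ofCore core

noncomputable instance : NormedCommRing PA :=
  { instNACG, (inferInstance : CommRing PA) with
    norm_mul_le := fun f g => (WS.mul_aux f.2 g.2).2 }

noncomputable instance : NormedAlgebra ℝ PA :=
  { (inferInstance : Algebra ℝ PA) with
    norm_smul_le := fun c f => (core.norm_smul c f).le }

noncomputable def toLp : PA ≃ₗᵢ[ℝ] lp (fun _ : Ix => ℝ) 1 where
  toFun f := ⟨fun d => f.cf d * wt d, by
    apply memℓp_gen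
    simpa [abs_mul, abs_of_pos (wt_pos _)] using f.summable⟩
  map_add' f g := by
    ext d
    simp [cf_add, add_mul]
    rfl
  map_smul' c f := by
    ext d
    simp [cf_smul, mul_assoc]
  invFun g := mk (fun d => g d / wt d) (by
    have := g.2.summable (by simp)
    simpa [abs_div, abs_of_pos (wt_pos _), (wt_pos _).ne'] using this)
  left_inv f := by
    apply ext'
    intro d
    simp [cf_mk, (wt_pos d).ne']
  right_inv g := by
    ext d
    simp [cf_mk, (wt_pos d).ne']
  norm_map' f := by
    rw [lp.norm_eq_tsum_rpow (by simp), norm_def]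
    simp [abs_of_pos (wt_pos _)]

instance : CompleteSpace PA := toLp.toIsometryEquiv.completeSpace

end PA

namespace PA

noncomputable abbrev e0 : Ix := Finsupp.single 0 1
noncomputable abbrev e1 : Ix := Finsupp.single 1 1

lemma inj_add (e : Ix) : Function.Injective (fun d : Ix => d + e) := add_left_injective e

lemma not_mem_range (i : Fin 2) (d : Ix) (h : d ∉ Set.range (fun d : Ix => d + Finsupp.single i 1)) :
    d i = 0 := by
  by_contra hd
  apply h
  refine ⟨d - Finsupp.single i 1, ?_⟩
  apply tsub_add_cancel_of_le
  rw [Finsupp.single_le_iff]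
  omega

/-- coefficients of the antiderivative in the second variable -/
noncomputable def Icf (f : PA) (d : Ix) : ℝ := if d 1 = 0 then 0 else f.cf (d - e1) / d 1

/-- coefficients of the antiderivative in variable 2 of the derivative in variable 1 -/
noncomputable def Jcf (f : PA) (d : Ix) : ℝ :=
  if d 1 = 0 then 0 else (d 0 + 1) * f.cf (d - e1 + e0) / d 1

lemma Icf_add (f : PA) (d : Ix) : Icf f (d + e1) = f.cf d / (d 1 + 1) := by
  simp [Icf]

lemma Jcf_add (f : PA) (d : Ix) : Jcf f (d + e1) = (d 0 + 1) * f.cf (d + e0) / (d 1 + 1) := by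
  simp [Jcf]

lemma wt_e1 (d : Ix) : wt (d + e1) ≤ wt d := by
  calc _ ≤ wt d * wt e1 := wt_add _ _
    _ = wt d := by simp [wt]

lemma wt_e0_e1 (d : Ix) : wt (d + e1) * (d 0 + 1) / (d 1 + 1) = wt (d + e0) := by
  have h1 := choose_pos' (d + e1)
  have h2 := choose_pos' (d + e0)
  have h := Nat.choose_succ_right_eq (d 0 + d 1 + 1) (d 0)
  have h3 : d 0 + d 1 + 1 - d 0 = d 1 + 1 := by omega
  rw [h3] at h
  have h4 : ((d 0 + d 1 + 1).choose (d 0 + 1) : ℝ) * (d 0 + 1)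
    = (d 0 + d 1 + 1).choose (d 0) * (d 1 + 1) := by exact_mod_cast h
  simp only [wt]
  simp only [Finsupp.add_apply, Finsupp.single_apply] at h1 h2 ⊢
  simp only [Fin.isValue, one_ne_zero, zero_ne_one, if_true, if_false, add_zero] at h1 h2 ⊢
  rw [show d 0 + 1 + d 1 = d 0 + d 1 + 1 by ring] at h2 ⊢
  rw [← add_assoc] at h1 ⊢
  field_simp
  linarith

lemma abs_Icf (f : PA) (d : Ix) : |Icf f (d + e1)| * wt (d + e1) ≤ |f.cf d| * wt d := by
  rw [Icf_add]
  apply mul_le_mul _ (wt_e1 d) (wt_pos _).le (abs_nonneg _)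
  rw [abs_div]
  apply div_le_self (abs_nonneg _)
  rw [abs_of_pos (by positivity)]
  have : (0:ℝ) ≤ d 1 := Nat.cast_nonneg _
  linarith

lemma abs_Jcf (f : PA) (d : Ix) :
    |Jcf f (d + e1)| * wt (d + e1) = |f.cf (d + e0)| * wt (d + e0) := by
  rw [Jcf_add, ← wt_e0_e1 d, abs_div, abs_mul, abs_of_pos (a := (d 0 : ℝ) + 1) (by positivity),
    abs_of_pos (a := (d 1 : ℝ) + 1) (by positivity)]
  ring

lemma I_summable (f : PA) : Summable fun d => |Icf f d| * wt d := by
  rw [← (inj_add e1).summable_iff]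
  · exact Summable.of_nonneg_of_le (fun d => mul_nonneg (abs_nonneg _) (wt_pos _).le)
      (fun d => abs_Icf f d) f.summable
  · intro d hd
    simp [Icf, not_mem_range 1 d hd]

lemma J_summable (f : PA) : Summable fun d => |Jcf f d| * wt d := by
  rw [← (inj_add e1).summable_iff]
  · exact (f.summable.comp_injective (inj_add e0)).congr (fun d => (abs_Jcf f d).symm)
  · intro d hd
    simp [Jcf, not_mem_range 1 d hd]

lemma I_norm (f : PA) : ‖mk (Icf f) (I_summable f)‖ ≤ 1 * ‖f‖ := by
  rw [norm_def, norm_def, one_mul, ← (inj_add e1).tsum_eq]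
  · exact Summable.tsum_le_tsum (abs_Icf f) ((I_summable f).comp_injective (inj_add e1)) f.summable
  · intro d hd
    by_contra h
    apply hd
    simp [cf_mk, Icf, not_mem_range 1 d h]

lemma J_norm (f : PA) : ‖mk (Jcf f) (J_summable f)‖ ≤ 1 * ‖f‖ := by
  rw [norm_def, norm_def, one_mul, ← (inj_add e1).tsum_eq]
  · calc _ = ∑' d : Ix, |f.cf (d + e0)| * wt (d + e0) := tsum_congr (abs_Jcf f)
      _ ≤ _ := tsum_comp_le_tsum_of_inj f.summable (fun d => mul_nonneg (abs_nonneg _) (wt_pos _).le)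
        (inj_add e0)
  · intro d hd
    by_contra h
    apply hd
    simp [cf_mk, Jcf, not_mem_range 1 d h]

/-- antiderivative in the second variable -/
noncomputable def I : PA →L[ℝ] PA :=
  LinearMap.mkContinuous
    { toFun := fun f => mk (Icf f) (I_summable f)
      map_add' := fun f g => by
        apply ext'
        intro d
        simp only [cf_add, cf_mk, Icf]
        split_ifs <;> ring
      map_smul' := fun c f => by
        apply ext'
        intro d
        simp only [cf_smul, cf_mk, Icf, RingHom.id_apply]
        split_ifs <;> ring } 1 I_norm

/-- antiderivative in the second variable of the derivative in the first -/
noncomputable def J : PA →L[ℝ] PA :=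
  LinearMap.mkContinuous
    { toFun := fun f => mk (Jcf f) (J_summable f)
      map_add' := fun f g => by
        apply ext'
        intro d
        simp only [cf_add, cf_mk, Jcf]
        split_ifs <;> ring
      map_smul' := fun c f => by
        apply ext'
        intro d
        simp only [cf_smul, cf_mk, Jcf, RingHom.id_apply]
        split_ifs <;> ring } 1 J_norm

lemma cf_I (f : PA) (d : Ix) : (I f).cf d = if d 1 = 0 then 0 else f.cf (d - e1) / d 1 := rfl
lemma cf_J (f : PA) (d : Ix) :
    (J f).cf d = if d 1 = 0 then 0 else (d 0 + 1) * f.cf (d - e1 + e0) / d 1 := rfl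
lemma cf_I_add (f : PA) (d : Ix) : (I f).cf (d + e1) = f.cf d / (d 1 + 1) := Icf_add f d

lemma I_J_comm (f : PA) : I (J f) = J (I f) := by
  apply ext'
  intro d
  rw [cf_I (J f), cf_J (I f)]
  split_ifs with h
  · rfl
  · rw [cf_I f, cf_J f]
    simp only [Finsupp.add_apply, Finsupp.tsub_apply, Finsupp.single_apply]
    simp only [Fin.isValue, one_ne_zero, zero_ne_one, if_true, if_false, add_zero, tsub_zero]
    split_ifs with h2
    · simp
    · rw [show d - e1 + e0 - e1 = d - e1 - e1 + e0 by
        ext i; fin_cases i <;> simp]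
      ring
end PA

namespace PA

/-- monomial -/
noncomputable def mon (z : ℝ × ℝ) (d : Ix) : ℝ := z.1 ^ d 0 * z.2 ^ d 1

lemma mon_add (z : ℝ × ℝ) (a b : Ix) : mon z (a + b) = mon z a * mon z b := by
  simp only [mon, Finsupp.add_apply, pow_add]
  ring

lemma mon_le {z : ℝ × ℝ} (h1 : |z.1| ≤ 1 / 2) (h2 : |z.2| ≤ 1 / 2) (d : Ix) :
    |mon z d| ≤ wt d := by
  refine le_trans ?_ (half_pow_le_wt d)
  rw [mon, abs_mul, abs_pow, abs_pow, pow_add]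
  gcongr

/-- evaluation -/
noncomputable def ev (z : ℝ × ℝ) (f : PA) : ℝ := ∑' d, f.cf d * mon z d

lemma ev_summable_abs {z : ℝ × ℝ} (h1 : |z.1| ≤ 1 / 2) (h2 : |z.2| ≤ 1 / 2) (f : PA) :
    Summable fun d => |f.cf d * mon z d| := by
  refine Summable.of_nonneg_of_le (fun d => abs_nonneg _) (fun d => ?_) f.summable
  rw [abs_mul]
  exact mul_le_mul_of_nonneg_left (mon_le h1 h2 d) (abs_nonneg _)

lemma ev_summable {z : ℝ × ℝ} (h1 : |z.1| ≤ 1 / 2) (h2 : |z.2| ≤ 1 / 2) (f : PA) :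
    Summable fun d => f.cf d * mon z d := (ev_summable_abs h1 h2 f).of_abs

lemma ev_add {z : ℝ × ℝ} (h1 : |z.1| ≤ 1 / 2) (h2 : |z.2| ≤ 1 / 2) (f g : PA) :
    ev z (f + g) = ev z f + ev z g := by
  unfold ev
  rw [← (ev_summable h1 h2 f).tsum_add (ev_summable h1 h2 g)]
  congr 1
  ext d
  rw [cf_add, add_mul]

lemma ev_mul {z : ℝ × ℝ} (h1 : |z.1| ≤ 1 / 2) (h2 : |z.2| ≤ 1 / 2) (f g : PA) :
    ev z (f * g) = ev z f * ev z g := by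
  unfold ev
  have hs : Summable fun x : Ix × Ix => (f.cf x.1 * mon z x.1) * (g.cf x.2 * mon z x.2) := by
    exact summable_mul_of_summable_norm (f := fun d => f.cf d * mon z d)
      (g := fun d => g.cf d * mon z d) (ev_summable_abs h1 h2 f) (ev_summable_abs h1 h2 g)
  rw [Summable.tsum_mul_tsum_eq_tsum_sum_antidiagonal (f := fun d => f.cf d * mon z d)
    (g := fun d => g.cf d * mon z d) (ev_summable h1 h2 f) (ev_summable h1 h2 g) hs]
  congr 1
  ext d
  rw [cf_mul, Finset.sum_mul]
  apply Finset.sum_congr rfl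
  intro kl hkl
  rw [Finset.HasAntidiagonal.mem_antidiagonal] at hkl
  rw [← hkl, mon_add]
  ring

lemma ev_algebraMap (z : ℝ × ℝ) (r : ℝ) : ev z (algebraMap ℝ PA r) = r := by
  unfold ev
  rw [tsum_eq_single 0]
  · simp [cf_algebraMap, mon]
  · intro d hd
    simp [cf_algebraMap, hd]

/-- evaluation as algebra homomorphism -/
noncomputable def evHom (z : ℝ × ℝ) (h1 : |z.1| ≤ 1 / 2) (h2 : |z.2| ≤ 1 / 2) : PA →ₐ[ℝ] ℝ where
  toFun := ev z
  map_one' := by simpa using ev_algebraMap z 1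
  map_mul' := ev_mul h1 h2
  map_zero' := by simpa using ev_algebraMap z 0
  map_add' := ev_add h1 h2
  commutes' := ev_algebraMap z

lemma ev_zero_I (f : PA) : ev (0, 0) (I f) = 0 := by
  unfold ev
  convert tsum_zero with d
  rw [cf_I, mon]
  split_ifs with h
  · simp
  · simp [h]

lemma aux_bound {s t : ℝ} (hs : |s| ≤ 1 / 4) (ht : |t| ≤ 1 / 4) (m n : ℕ) :
    |(m : ℝ) * s ^ (m - 1) * t ^ n| ≤ 4 * (1 / 2) ^ (m + n) := by
  rcases m with _ | m
  · simp
  rw [abs_mul, abs_mul, abs_pow, abs_pow, Nat.abs_cast]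
  have h2 : ((m + 1 : ℕ) : ℝ) ≤ 2 ^ (m + 1) := by exact_mod_cast (Nat.lt_two_pow_self).le
  calc _ ≤ (2 : ℝ) ^ (m + 1) * (1 / 4) ^ m * (1 / 4) ^ n := by
        simp only [Nat.add_sub_cancel]
        gcongr
    _ ≤ (2 : ℝ) ^ (m + 1) * (1 / 4) ^ m * (1 / 2) ^ n := by
        gcongr
        norm_num
    _ = 4 * (1 / 2) ^ (m + 1 + n) := by
        rw [show (1 / 4 : ℝ) = 1 / 2 * (1 / 2) by norm_num, mul_pow, pow_add, pow_add]
        have : (2 : ℝ) ^ m * (1 / 2) ^ m = 1 := by rw [← mul_pow]; norm_num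
        linear_combination (2 * (1 / 2 : ℝ) ^ m * (1 / 2) ^ n) * this

lemma hasDeriv1 {z : ℝ × ℝ} (h1 : |z.1| < 1 / 4) (h2 : |z.2| < 1 / 4) (f : PA) :
    HasDerivAt (fun s => ev (s, z.2) f) (∑' d : Ix, (d 0 + 1) * f.cf (d + e0) * mon z d) z.1 := by
  have key : HasDerivAt (fun s => ev (s, z.2) f)
      (∑' d : Ix, f.cf d * (d 0 * z.1 ^ (d 0 - 1) * z.2 ^ d 1)) z.1 := by
    unfold ev
    refine hasDerivAt_tsum_of_isPreconnected (u := fun d => |f.cf d| * wt d * 4)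
      (g := fun (d : Ix) s => f.cf d * mon (s, z.2) d)
      (g' := fun (d : Ix) s => f.cf d * (d 0 * s ^ (d 0 - 1) * z.2 ^ d 1))
      (t := Set.Ioo (-(1 / 4)) (1 / 4)) (y₀ := z.1)
      (f.summable.mul_right 4) isOpen_Ioo isPreconnected_Ioo ?_ ?_ (abs_lt.1 h1) ?_ (abs_lt.1 h1)
    · intro d s _
      simp only [mon]
      exact (((hasDerivAt_pow (d 0) s).mul_const _).const_mul _)
    · intro d s hs
      rw [Real.norm_eq_abs, abs_mul, mul_assoc |f.cf d|]
      apply mul_le_mul_of_nonneg_left _ (abs_nonneg _)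
      refine (aux_bound (abs_lt.2 hs).le h2.le _ _).trans ?_
      linarith [half_pow_le_wt d]
    · exact ev_summable (z := (z.1, z.2)) (by linarith) (by linarith) f
  convert key using 1
  rw [← (inj_add e0).tsum_eq (f := fun d : Ix => f.cf d * (d 0 * z.1 ^ (d 0 - 1) * z.2 ^ d 1))]
  · apply tsum_congr
    intro d
    simp [mon]
    ring
  · intro d hd
    by_contra h
    apply hd
    simp [not_mem_range 0 d h]

lemma hasDeriv2 {z : ℝ × ℝ} (h1 : |z.1| < 1 / 4) (h2 : |z.2| < 1 / 4) (f : PA) :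
    HasDerivAt (fun s => ev (z.1, s) f) (∑' d : Ix, (d 1 + 1) * f.cf (d + e1) * mon z d) z.2 := by
  have key : HasDerivAt (fun s => ev (z.1, s) f)
      (∑' d : Ix, f.cf d * (z.1 ^ d 0 * (d 1 * z.2 ^ (d 1 - 1)))) z.2 := by
    unfold ev
    refine hasDerivAt_tsum_of_isPreconnected (u := fun d => |f.cf d| * wt d * 4)
      (g := fun (d : Ix) s => f.cf d * mon (z.1, s) d)
      (g' := fun (d : Ix) s => f.cf d * (z.1 ^ d 0 * (d 1 * s ^ (d 1 - 1))))
      (t := Set.Ioo (-(1 / 4)) (1 / 4)) (y₀ := z.2)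
      (f.summable.mul_right 4) isOpen_Ioo isPreconnected_Ioo ?_ ?_ (abs_lt.1 h2) ?_ (abs_lt.1 h2)
    · intro d s _
      simp only [mon]
      exact (((hasDerivAt_pow (d 1) s).const_mul _).const_mul _)
    · intro d s hs
      rw [Real.norm_eq_abs, abs_mul, mul_assoc |f.cf d|, mul_comm (z.1 ^ d 0)]
      apply mul_le_mul_of_nonneg_left _ (abs_nonneg _)
      refine (aux_bound (abs_lt.2 hs).le h1.le _ _).trans ?_
      rw [add_comm]
      linarith [half_pow_le_wt d]
    · exact ev_summable (z := (z.1, z.2)) (by linarith) (by linarith) f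
  convert key using 1
  rw [← (inj_add e1).tsum_eq (f := fun d : Ix => f.cf d * (z.1 ^ d 0 * (d 1 * z.2 ^ (d 1 - 1))))]
  · apply tsum_congr
    intro d
    simp [mon]
    ring
  · intro d hd
    by_contra h
    apply hd
    simp [not_mem_range 1 d h]

lemma hasDeriv2_I {z : ℝ × ℝ} (h1 : |z.1| < 1 / 4) (h2 : |z.2| < 1 / 4) (f : PA) :
    HasDerivAt (fun s => ev (z.1, s) (I f)) (ev z f) z.2 := by
  convert hasDeriv2 h1 h2 (I f) using 1
  unfold ev
  apply tsum_congr
  intro d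
  rw [cf_I_add]
  have : (d 1 : ℝ) + 1 ≠ 0 := by positivity
  field_simp

lemma hasDeriv1_I {z : ℝ × ℝ} (h1 : |z.1| < 1 / 4) (h2 : |z.2| < 1 / 4) (f : PA) :
    HasDerivAt (fun s => ev (s, z.2) (I f)) (ev z (J f)) z.1 := by
  convert hasDeriv1 h1 h2 (I f) using 1
  unfold ev
  apply tsum_congr
  intro d
  rw [cf_I, cf_J, show d + e0 - e1 = d - e1 + e0 by ext i; fin_cases i <;> simp]
  simp only [Finsupp.add_apply, Finsupp.single_apply]
  simp only [Fin.isValue, zero_ne_one, if_false, add_zero]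
  split_ifs
  · simp
  · ring

end PA

open scoped BoundedContinuousFunction

lemma summable_V {B : Type*} [NormedAddCommGroup B] [NormedSpace ℝ B] [CompleteSpace B]
    (c : ℕ → B) (C : ℝ) (hc : ∀ n, ‖c n‖ ≤ C * 2 ^ n) {x : ℝ} (hx : |x| < 1 / 2) :
    Summable fun n => x ^ n • c n := by
  have hg : Summable fun n : ℕ => C * (2 * |x|) ^ n :=
    (summable_geometric_of_lt_one (by positivity) (by linarith)).mul_left C
  refine Summable.of_norm_bounded hg (fun n => ?_)
  rw [norm_smul, norm_pow, Real.norm_eq_abs, mul_pow]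
  calc _ ≤ |x| ^ n * (C * 2 ^ n) := mul_le_mul_of_nonneg_left (hc n) (by positivity)
    _ = _ := by ring

lemma analytic_V {B : Type*} [NormedAddCommGroup B] [NormedSpace ℝ B] [CompleteSpace B]
    (c : ℕ → B) (C : ℝ) (hc : ∀ n, ‖c n‖ ≤ C * 2 ^ n) :
    AnalyticOnNhd ℝ (fun x : ℝ => ∑' n, x ^ n • c n) (Metric.ball 0 (1 / 2)) := by
  let p : FormalMultilinearSeries ℝ ℝ B := fun n => ContinuousMultilinearMap.mkPiRing ℝ (Fin n) (c n)
  have hr : ((1 / 2 : NNReal) : ENNReal) ≤ p.radius := by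
    apply p.le_radius_of_bound C
    intro n
    simp only [p, ContinuousMultilinearMap.norm_mkPiRing]
    calc ‖c n‖ * ((1 / 2 : NNReal) : ℝ) ^ n ≤ (C * 2 ^ n) * ((1 / 2 : NNReal) : ℝ) ^ n := by
          apply mul_le_mul_of_nonneg_right (hc n) (by positivity)
      _ = C := by
          rw [mul_assoc, ← mul_pow]
          norm_num
  have hp : 0 < p.radius := lt_of_lt_of_le (by norm_num) hr
  have h := (p.hasFPowerSeriesOnBall hp).analyticOnNhd
  have h2 : p.sum = fun x : ℝ => ∑' n, x ^ n • c n := by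
    ext x
    simp [FormalMultilinearSeries.sum, p]
  rw [h2] at h
  apply h.mono
  intro x hx
  rw [Metric.mem_eball, edist_dist]
  refine lt_of_lt_of_le ?_ hr
  rw [Metric.mem_ball] at hx
  rw [ENNReal.ofReal_lt_iff_lt_toReal dist_nonneg (by simp)]
  simpa using hx

lemma isOpen_box (r s : ℝ) : IsOpen {z : ℝ × ℝ | |z.1| < r ∧ |z.2| < s} :=
  (isOpen_lt continuous_fst.abs continuous_const).and
    (isOpen_lt continuous_snd.abs continuous_const)

namespace PA

noncomputable def ixEquiv : Ix ≃ ℕ × ℕ := Finsupp.equivFunOnFinite.trans (finTwoArrowEquiv ℕ)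

lemma ixEquiv_symm_zero (q : ℕ × ℕ) : ixEquiv.symm q 0 = q.1 := by
  simp [ixEquiv, Finsupp.equivFunOnFinite]
  rfl
lemma ixEquiv_symm_one (q : ℕ × ℕ) : ixEquiv.symm q 1 = q.2 := by
  simp [ixEquiv, Finsupp.equivFunOnFinite]
  rfl

lemma abs_cf_le (f : PA) (d : Ix) : |f.cf d| ≤ ‖f‖ * 2 ^ (d 0 + d 1) := by
  have h1 := term_le f d
  have h2 := half_pow_le_wt d
  have h3 : |f.cf d| * (1 / 2) ^ (d 0 + d 1) ≤ ‖f‖ :=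
    (mul_le_mul_of_nonneg_left h2 (abs_nonneg _)).trans h1
  calc |f.cf d| = |f.cf d| * (1 / 2) ^ (d 0 + d 1) * 2 ^ (d 0 + d 1) := by
        rw [mul_assoc, ← mul_pow]; norm_num
    _ ≤ _ := mul_le_mul_of_nonneg_right h3 (by positivity)

noncomputable def row (f : PA) (n : ℕ) : ℕ →ᵇ ℝ :=
  BoundedContinuousFunction.ofNormedAddCommGroupDiscrete
    (fun m => f.cf (ixEquiv.symm (n, m)) * (1 / 2) ^ m) (‖f‖ * 2 ^ n) (by
      intro m
      have h := abs_cf_le f (ixEquiv.symm (n, m))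
      rw [ixEquiv_symm_zero, ixEquiv_symm_one] at h
      rw [Real.norm_eq_abs, abs_mul, abs_of_pos (a := (1 / 2 : ℝ) ^ m) (by positivity)]
      calc _ ≤ (‖f‖ * 2 ^ (n + m)) * (1 / 2) ^ m := mul_le_mul_of_nonneg_right h (by positivity)
        _ = ‖f‖ * 2 ^ n * (2 * (1 / 2)) ^ m := by rw [pow_add, mul_pow]; ring
        _ = _ := by norm_num)

lemma row_apply (f : PA) (n m : ℕ) : row f n m = f.cf (ixEquiv.symm (n, m)) * (1 / 2) ^ m := rfl

lemma row_norm (f : PA) (n : ℕ) : ‖row f n‖ ≤ ‖f‖ * 2 ^ n := by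
  rw [BoundedContinuousFunction.norm_le (by positivity)]
  intro m
  have h := abs_cf_le f (ixEquiv.symm (n, m))
  rw [ixEquiv_symm_zero, ixEquiv_symm_one] at h
  rw [row_apply, Real.norm_eq_abs, abs_mul, abs_of_pos (a := (1 / 2 : ℝ) ^ m) (by positivity)]
  calc _ ≤ (‖f‖ * 2 ^ (n + m)) * (1 / 2) ^ m := mul_le_mul_of_nonneg_right h (by positivity)
    _ = ‖f‖ * 2 ^ n * (2 * (1 / 2)) ^ m := by rw [pow_add, mul_pow]; ring
    _ = _ := by norm_num

noncomputable def del (m : ℕ) : (ℕ →ᵇ ℝ) →L[ℝ] ℝ :=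
  (2 : ℝ) ^ m • BoundedContinuousFunction.evalCLM ℝ m

lemma del_norm (m : ℕ) : ‖del m‖ ≤ 1 * 2 ^ m := by
  apply ContinuousLinearMap.opNorm_le_bound _ (by positivity)
  intro g
  have h : del m g = 2 ^ m * g m := rfl
  rw [h, norm_mul, norm_pow, Real.norm_two, one_mul]
  exact mul_le_mul_of_nonneg_left (g.norm_coe_le_norm m) (by positivity)

lemma ev_eq_pair (f : PA) {z : ℝ × ℝ} (h1 : |z.1| < 1 / 2) (h2 : |z.2| < 1 / 2) :
    ev z f = (∑' m, z.2 ^ m • del m) (∑' n, z.1 ^ n • row f n) := by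
  have hs1 := summable_V (row f) _ (row_norm f) h1
  have hs2 := summable_V del _ del_norm h2
  set F := ∑' n, z.1 ^ n • row f n with hF
  have e1 : (∑' m, z.2 ^ m • del m) F = ∑' m, (z.2 ^ m • del m) F :=
    (ContinuousLinearMap.apply ℝ ℝ F).map_tsum hs2
  have e2 : ∀ m, F m = ∑' n, z.1 ^ n * row f n m := fun m =>
    (BoundedContinuousFunction.evalCLM ℝ m).map_tsum hs1
  rw [e1, ev, ← ixEquiv.symm.tsum_eq, ← (Equiv.prodComm ℕ ℕ).tsum_eq]
  rw [Summable.tsum_prod]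
  · apply tsum_congr
    intro m
    simp only [del, smul_apply, BoundedContinuousFunction.evalCLM_apply]
    rw [e2, smul_eq_mul, smul_eq_mul, ← tsum_mul_left, ← tsum_mul_left]
    apply tsum_congr
    intro n
    rw [row_apply, mon]
    simp only [Equiv.prodComm_apply, Prod.swap_prod_mk, ixEquiv_symm_zero, ixEquiv_symm_one]
    have : (2 : ℝ) ^ m * (1 / 2) ^ m = 1 := by rw [← mul_pow]; norm_num
    linear_combination (-z.2 ^ m * z.1 ^ n * f.cf (ixEquiv.symm (n, m))) * this
  · have := ev_summable h1.le h2.le f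
    exact (ixEquiv.symm.summable_iff.2 this).comp_injective (Equiv.prodComm ℕ ℕ).injective

lemma ev_analytic (f : PA) : AnalyticOnNhd ℝ (fun z : ℝ × ℝ => ev z f)
    {z | |z.1| < 1 / 2 ∧ |z.2| < 1 / 2} := by
  intro z hz
  have hA := analytic_V (row f) _ (row_norm f) z.1 (by simpa using hz.1)
  have hB := analytic_V del _ del_norm z.2 (by simpa using hz.2)
  have hA' : AnalyticAt ℝ (fun z : ℝ × ℝ => ∑' n, z.1 ^ n • row f n) z :=
    hA.comp_of_eq analyticAt_fst rfl
  have hB' : AnalyticAt ℝ (fun z : ℝ × ℝ => ∑' m, z.2 ^ m • del m) z :=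
    hB.comp_of_eq analyticAt_snd rfl
  have h := AnalyticAt.comp₂
    ((ContinuousLinearMap.id ℝ ((ℕ →ᵇ ℝ) →L[ℝ] ℝ)).analyticAt_bilinear (_, _)) hB' hA'
  refine h.congr ?_
  have : IsOpen {z : ℝ × ℝ | |z.1| < 1 / 2 ∧ |z.2| < 1 / 2} :=
    isOpen_box _ _
  filter_upwards [this.mem_nhds hz] with y hy
  exact (ev_eq_pair f hy.1 hy.2).symm

end PA


namespace PA

abbrev Tx := Σ k : ℕ, Finset (Fin k)

noncomputable def tidx (t : Tx) : Ix := ixEquiv.symm (t.2.card, t.1 - t.2.card)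

noncomputable def tP (p : FormalMultilinearSeries ℝ (ℝ × ℝ) ℝ) (t : Tx) : ℝ :=
  p t.1 (t.2.piecewise (fun _ => ((1 : ℝ), (0 : ℝ))) (fun _ => ((0 : ℝ), (1 : ℝ))))

lemma tidx_add (t : Tx) : tidx t 0 + tidx t 1 = t.1 := by
  rw [tidx, ixEquiv_symm_zero, ixEquiv_symm_one]
  have := Finset.card_le_univ t.2
  simp at this
  simp
  omega

lemma tP_le (p : FormalMultilinearSeries ℝ (ℝ × ℝ) ℝ) (t : Tx) : |tP p t| ≤ ‖p t.1‖ := by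
  refine ((p t.1).le_opNorm _).trans ?_
  refine mul_le_of_le_one_right (norm_nonneg _) ?_
  apply Finset.prod_le_one (fun _ _ => norm_nonneg _)
  intro i _
  by_cases h : i ∈ t.2 <;> simp [h, Prod.norm_def]

lemma expand (p : FormalMultilinearSeries ℝ (ℝ × ℝ) ℝ) (z : ℝ × ℝ) (k : ℕ) :
    p k (fun _ => z) = ∑ s : Finset (Fin k), tP p ⟨k, s⟩ * mon z (tidx ⟨k, s⟩) := by
  have hz : (fun _ : Fin k => z) =
      (fun _ => z.1 • ((1 : ℝ), (0 : ℝ))) + (fun _ => z.2 • ((0 : ℝ), (1 : ℝ))) := by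
    ext i <;> simp
  have h1 := (p k).toMultilinearMap.map_add_univ (fun _ => z.1 • ((1 : ℝ), (0 : ℝ)))
    (fun _ => z.2 • ((0 : ℝ), (1 : ℝ)))
  rw [← hz] at h1
  refine h1.trans (Finset.sum_congr rfl fun s _ => ?_)
  have h2 : (s.piecewise (fun _ => z.1 • ((1 : ℝ), (0 : ℝ))) (fun _ => z.2 • ((0 : ℝ), (1 : ℝ)))
      : Fin k → ℝ × ℝ) = fun i => (s.piecewise (fun _ => z.1) (fun _ => z.2) i) •
        (s.piecewise (fun _ => ((1 : ℝ), (0 : ℝ))) (fun _ => ((0 : ℝ), (1 : ℝ))) i) := by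
    ext1 i
    by_cases h : i ∈ s <;> simp [h]
  rw [h2, MultilinearMap.map_smul_univ, Finset.prod_piecewise]
  simp only [tP, mon, tidx, ixEquiv_symm_zero, ixEquiv_symm_one, smul_eq_mul, Finset.prod_const,
    Finset.univ_inter, ← Finset.compl_eq_univ_sdiff, Finset.card_compl, Fintype.card_fin]
  rw [mul_comm]
  rfl

lemma abs_tsum_le_aux {ι : Type*} (g : ι → ℝ) (h : Summable fun i => |g i|) :
    |∑' i, g i| ≤ ∑' i, |g i| := by
  simp only [← Real.norm_eq_abs] at h ⊢
  exact norm_tsum_le_tsum_norm h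

set_option maxHeartbeats 1000000 in
lemma taylor {f : ℝ × ℝ → ℝ} (hf : AnalyticAt ℝ f 0) :
    ∃ r : ℝ, 0 < r ∧ ∃ c : Ix → ℝ, (Summable fun d => |c d| * r ^ (d 0 + d 1)) ∧
      ∀ z : ℝ × ℝ, |z.1| ≤ r → |z.2| ≤ r → HasSum (fun d => c d * mon z d) (f z) := by
  obtain ⟨p, R, hp⟩ := hf
  obtain ⟨ρ, hρ0, hρR⟩ := ENNReal.lt_iff_exists_nnreal_btwn.1 hp.r_pos
  have hρ : 0 < (ρ : ℝ) := by exact_mod_cast hρ0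
  have hs0 := p.summable_norm_mul_pow (lt_of_lt_of_le hρR hp.r_le)
  have hr : 0 < (ρ : ℝ) / 2 := by positivity
  have hsT : Summable fun t : Tx => |tP p t| * ((ρ : ℝ) / 2) ^ t.1 := by
    rw [summable_sigma_of_nonneg (fun t => by positivity)]
    refine ⟨fun k => (hasSum_fintype _).summable, ?_⟩
    refine Summable.of_nonneg_of_le (fun k => tsum_nonneg fun s => by positivity) (fun k => ?_) hs0
    rw [tsum_fintype]
    calc ∑ s : Finset (Fin k), |tP p ⟨k, s⟩| * ((ρ : ℝ) / 2) ^ k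
        ≤ ∑ s : Finset (Fin k), ‖p k‖ * ((ρ : ℝ) / 2) ^ k :=
          Finset.sum_le_sum fun s _ => mul_le_mul_of_nonneg_right (tP_le p ⟨k, s⟩) (by positivity)
      _ = ‖p k‖ * (ρ : ℝ) ^ k := by
          simp [Finset.sum_const, div_pow]
          field_simp
  refine ⟨ρ / 2, hr, fun d => ∑' t : tidx ⁻¹' {d}, tP p t, ?_, ?_⟩
  · have h1 := (hsT.hasSum.tsum_fiberwise tidx).summable
    refine Summable.of_nonneg_of_le (fun d => by positivity) (fun d => ?_) h1
    have hfib : ∀ t : tidx ⁻¹' {d}, (t : Tx).1 = d 0 + d 1 := by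
      rintro ⟨t, ht⟩
      rw [Set.mem_preimage, Set.mem_singleton_iff] at ht
      have h0 := tidx_add t
      rw [ht] at h0
      exact h0.symm
    simp only [hfib]
    rw [tsum_mul_right]
    apply mul_le_mul_of_nonneg_right _ (by positivity)
    have h2 : Summable fun t : tidx ⁻¹' {d} => |tP p t| := by
      have h3 := hsT.comp_injective (Subtype.val_injective (p := fun t => t ∈ tidx ⁻¹' {d}))
      have h4 : Summable fun t : tidx ⁻¹' {d} => |tP p t| * ((ρ : ℝ) / 2) ^ (d 0 + d 1) := by
        refine h3.congr (fun t => ?_)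
        simp only [Function.comp, hfib t]
      exact (summable_mul_right_iff (pow_pos hr _).ne').1 h4
    exact abs_tsum_le_aux _ h2
  · intro z hz1 hz2
    have hmon : ∀ t : Tx, |mon z (tidx t)| ≤ ((ρ : ℝ) / 2) ^ t.1 := by
      intro t
      rw [← tidx_add t, mon, abs_mul, abs_pow, abs_pow, pow_add]
      gcongr
    have hsum : Summable fun t : Tx => tP p t * mon z (tidx t) := by
      refine Summable.of_norm_bounded hsT (fun t => ?_)
      rw [Real.norm_eq_abs, abs_mul]
      exact mul_le_mul_of_nonneg_left (hmon t) (abs_nonneg _)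
    have hz : z ∈ Metric.eball (0 : ℝ × ℝ) R := by
      rw [Metric.mem_eball, edist_zero_right]
      refine lt_of_le_of_lt ?_ hρR
      rw [← ofReal_norm, ← ENNReal.ofReal_coe_nnreal]
      apply ENNReal.ofReal_le_ofReal
      rw [Prod.norm_def]
      simp only [Real.norm_eq_abs]
      exact max_le (by linarith) (by linarith)
    have h1 := hp.hasSum hz
    rw [zero_add] at h1
    have h2 : HasSum (fun t : Tx => tP p t * mon z (tidx t)) (f z) := by
      refine HasSum.sigma_of_hasSum h1 (fun k => ?_) hsum
      rw [expand]
      exact hasSum_fintype _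
    have h3 := h2.tsum_fiberwise tidx
    have h4 : (fun d : Ix => (∑' t : tidx ⁻¹' {d}, tP p t) * mon z d) =
        fun d => ∑' t : tidx ⁻¹' {d}, tP p t * mon z (tidx t) := by
      ext d
      rw [← tsum_mul_right]
      apply tsum_congr
      rintro ⟨t, ht⟩
      rw [Set.mem_preimage, Set.mem_singleton_iff] at ht
      simp only [ht]
    rw [h4]
    exact h3

end PA

open Filter Topology
namespace PA

/-- evaluation in scaled variables -/
noncomputable def evs (ε : ℝ) (z : ℝ × ℝ) (f : PA) : ℝ := ev (z.1 / ε, z.2 / ε ^ 2) f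

lemma ix_ne_zero {d : Ix} (hd : d ≠ 0) : d 0 + d 1 ≠ 0 := by
  intro h
  apply hd
  ext i
  fin_cases i <;> simp <;> omega

lemma embed {f : ℝ × ℝ → ℝ} (hf : AnalyticAt ℝ f 0) :
    ∃ k : ℝ → PA, Tendsto k (𝓝[>] 0) (𝓝 (algebraMap ℝ PA (f 0))) ∧
      ∀ᶠ ε in 𝓝[>] (0 : ℝ), ∀ z : ℝ × ℝ, |z.1| < ε / 4 → |z.2| < ε ^ 2 / 4 →
        evs ε z (k ε) = f z := by
  obtain ⟨r, hr, c, hsum, hev⟩ := taylor hf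
  have hc0 : c 0 = f 0 := by
    have h1 := hev 0 (by simpa using hr.le) (by simpa using hr.le)
    have h2 : HasSum (fun d => c d * mon 0 d) (c 0 * mon 0 0) := by
      apply hasSum_single
      intro d hd
      have := ix_ne_zero hd
      rw [mon]
      by_cases h : d 0 = 0
      · have h' : d 1 ≠ 0 := by omega
        simp [h']
      · simp [h]
    have h3 := h1.unique h2
    rw [h3]
    simp [mon]
  have key : ∀ ε : ℝ, 0 < ε → ε ≤ r → ε ≤ 1 → ∀ d : Ix,
      |c d * ε ^ (d 0 + 2 * d 1)| * wt d ≤ |c d| * r ^ (d 0 + d 1) * (ε / r) ^ (d 0 + d 1) := by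
    intro ε h0 h1 h2 d
    rw [mul_assoc, ← mul_pow, mul_div_cancel₀ _ hr.ne', abs_mul, abs_of_pos (pow_pos h0 _)]
    have h3 : ε ^ (d 0 + 2 * d 1) ≤ ε ^ (d 0 + d 1) :=
      pow_le_pow_of_le_one h0.le h2 (by omega)
    calc |c d| * ε ^ (d 0 + 2 * d 1) * wt d ≤ |c d| * ε ^ (d 0 + 2 * d 1) * 1 :=
          mul_le_mul_of_nonneg_left (wt_le_one d) (by positivity)
      _ = |c d| * ε ^ (d 0 + 2 * d 1) := mul_one _
      _ ≤ _ := mul_le_mul_of_nonneg_left h3 (abs_nonneg _)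
  have hS : ∀ ε : ℝ, 0 < ε → ε ≤ r → ε ≤ 1 →
      Summable fun d : Ix => |c d * ε ^ (d 0 + 2 * d 1)| * wt d := by
    intro ε h0 h1 h2
    refine Summable.of_nonneg_of_le (fun d => mul_nonneg (abs_nonneg _) (wt_pos d).le)
      (fun d => (key ε h0 h1 h2 d).trans ?_) hsum
    have : (ε / r) ^ (d 0 + d 1) ≤ 1 := pow_le_one₀ (by positivity) (by rw [div_le_one hr]; exact h1)
    exact mul_le_of_le_one_right (by positivity) this
  classical
  let k : ℝ → PA := fun ε =>
    if h : Summable fun d : Ix => |c d * ε ^ (d 0 + 2 * d 1)| * wt d then mk _ h else 0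
  have hk : ∀ ε : ℝ, 0 < ε → ε ≤ r → ε ≤ 1 → ∀ d, (k ε).cf d = c d * ε ^ (d 0 + 2 * d 1) := by
    intro ε h0 h1 h2 d
    simp only [k, dif_pos (hS ε h0 h1 h2), cf_mk]
  have hmem : ∀ᶠ ε in 𝓝[>] (0 : ℝ), 0 < ε ∧ ε ≤ r ∧ ε ≤ 1 := by
    have h1 : ∀ᶠ ε in 𝓝[>] (0 : ℝ), ε < r := nhdsWithin_le_nhds (gt_mem_nhds hr)
    have h2 : ∀ᶠ ε in 𝓝[>] (0 : ℝ), ε < 1 := nhdsWithin_le_nhds (gt_mem_nhds one_pos)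
    filter_upwards [self_mem_nhdsWithin, h1, h2] with ε a b c
    exact ⟨a, b.le, c.le⟩
  refine ⟨k, ?_, ?_⟩
  · rw [tendsto_iff_norm_sub_tendsto_zero]
    have hlim : Tendsto (fun ε : ℝ => (∑' d : Ix, |c d| * r ^ (d 0 + d 1)) * (ε / r)) (𝓝[>] 0)
        (𝓝 0) := by
      have : Tendsto (fun ε : ℝ => (∑' d : Ix, |c d| * r ^ (d 0 + d 1)) * (ε / r)) (𝓝 0)
          (𝓝 ((∑' d : Ix, |c d| * r ^ (d 0 + d 1)) * (0 / r))) := by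
        apply Continuous.tendsto
        fun_prop
      simp only [zero_div, mul_zero] at this
      exact this.mono_left nhdsWithin_le_nhds
    refine squeeze_zero' (Eventually.of_forall fun ε => norm_nonneg _) ?_ hlim
    filter_upwards [hmem] with ε hε
    obtain ⟨h0, h1, h2⟩ := hε
    rw [norm_def, ← tsum_mul_right]
    refine Summable.tsum_le_tsum (fun d => ?_) (summable _) (hsum.mul_right _)
    rw [cf_sub, cf_algebraMap, hk ε h0 h1 h2]
    by_cases hd : d = 0
    · subst hd
      simp [hc0]
      positivity
    · simp only [hd, if_false, sub_zero]
      refine (key ε h0 h1 h2 d).trans ?_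
      apply mul_le_mul_of_nonneg_left _ (by positivity)
      exact pow_le_of_le_one (by positivity) (by rw [div_le_one hr]; exact h1) (ix_ne_zero hd)
  · filter_upwards [hmem] with ε hε z hz1 hz2
    obtain ⟨h0, h1, h2⟩ := hε
    have hz1' : |z.1| ≤ r := by linarith
    have hz2' : |z.2| ≤ r := by nlinarith
    have h3 := hev z hz1' hz2'
    rw [evs, ev, ← h3.tsum_eq]
    apply tsum_congr
    intro d
    rw [hk ε h0 h1 h2, mon, mon, div_pow, div_pow, pow_add, pow_mul]
    have := h0.ne'
    field_simp

lemma scaled_mem {ε : ℝ} (h0 : 0 < ε) {z : ℝ × ℝ} (h1 : |z.1| < ε / 4) (h2 : |z.2| < ε ^ 2 / 4) :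
    |z.1 / ε| < 1 / 4 ∧ |z.2 / ε ^ 2| < 1 / 4 := by
  rw [abs_div, abs_div, abs_of_pos h0, abs_of_pos (pow_pos h0 2), div_lt_iff₀ h0,
    div_lt_iff₀ (pow_pos h0 2)]
  constructor <;> linarith

/-- the box on which scaled evaluation is used -/
def box (ε : ℝ) : Set (ℝ × ℝ) := {z | |z.1| < ε / 4 ∧ |z.2| < ε ^ 2 / 4}

lemma isOpen_sbox (ε : ℝ) : IsOpen (box ε) := isOpen_box _ _

noncomputable def evsHom {ε : ℝ} (h0 : 0 < ε) {z : ℝ × ℝ} (hz : z ∈ box ε) : PA →ₐ[ℝ] ℝ :=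
  evHom (z.1 / ε, z.2 / ε ^ 2) (by have := (scaled_mem h0 hz.1 hz.2).1; simp only; linarith)
    (by have := (scaled_mem h0 hz.1 hz.2).2; simp only; linarith)

lemma evsHom_apply {ε : ℝ} (h0 : 0 < ε) {z : ℝ × ℝ} (hz : z ∈ box ε) (f : PA) :
    evsHom h0 hz f = evs ε z f := rfl

lemma evs_analytic {ε : ℝ} (h0 : 0 < ε) (f : PA) :
    AnalyticOnNhd ℝ (fun z => evs ε z f) (box ε) := by
  intro z hz
  have h := ev_analytic f (z.1 / ε, z.2 / ε ^ 2) (by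
    have := scaled_mem h0 hz.1 hz.2
    constructor <;> simp only <;> linarith)
  have h2 : AnalyticAt ℝ (fun z : ℝ × ℝ => (z.1 / ε, z.2 / ε ^ 2)) z := by
    apply AnalyticAt.prod
    · simp only [div_eq_mul_inv]
      exact analyticAt_fst.mul analyticAt_const
    · simp only [div_eq_mul_inv]
      exact analyticAt_snd.mul analyticAt_const
  exact h.comp_of_eq h2 rfl

noncomputable def Is (ε : ℝ) : PA →L[ℝ] PA := ε ^ 2 • I
noncomputable def Js (ε : ℝ) : PA →L[ℝ] PA := ε • J

lemma Is_tendsto : Tendsto Is (𝓝[>] 0) (𝓝 0) := by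
  have : Tendsto Is (𝓝 0) (𝓝 (Is 0)) := by
    apply Continuous.tendsto
    unfold Is
    fun_prop
  rw [show Is 0 = 0 by simp [Is]] at this
  exact this.mono_left nhdsWithin_le_nhds

lemma Js_tendsto : Tendsto Js (𝓝[>] 0) (𝓝 0) := by
  have : Tendsto Js (𝓝 0) (𝓝 (Js 0)) := by
    apply Continuous.tendsto
    unfold Js
    fun_prop
  rw [show Js 0 = 0 by simp [Js]] at this
  exact this.mono_left nhdsWithin_le_nhds

lemma Is_Js_comm (ε : ℝ) (f : PA) : Is ε (Js ε f) = Js ε (Is ε f) := by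
  simp only [Is, Js, smul_apply, map_smul, I_J_comm]
  rw [smul_comm]

lemma evs_smul {ε : ℝ} (h0 : 0 < ε) {z : ℝ × ℝ} (hz : z ∈ box ε) (c : ℝ) (f : PA) :
    evs ε z (c • f) = c * evs ε z f := by
  rw [← evsHom_apply h0 hz, ← evsHom_apply h0 hz, map_smul, smul_eq_mul]

lemma ev_smul' {z : ℝ × ℝ} (c : ℝ) (f : PA) : ev z (c • f) = c * ev z f := by
  rw [ev, ev, ← tsum_mul_left]
  apply tsum_congr
  intro d
  rw [cf_smul, mul_assoc]

lemma hasDeriv2_Is {ε : ℝ} (h0 : 0 < ε) {z : ℝ × ℝ} (hz : z ∈ box ε) (f : PA) :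
    HasDerivAt (fun s => evs ε (z.1, s) (Is ε f)) (evs ε z f) z.2 := by
  have hm := scaled_mem h0 hz.1 hz.2
  have h := hasDeriv2_I (z := (z.1 / ε, z.2 / ε ^ 2)) hm.1 hm.2 f
  have h2 : HasDerivAt (fun s : ℝ => s / ε ^ 2) (1 / ε ^ 2) z.2 := (hasDerivAt_id z.2).div_const _
  have h3 := (HasDerivAt.comp z.2 h h2).const_mul (ε ^ 2)
  simp only [evs, Is, smul_apply, ev_smul']
  have hne := h0.ne'
  refine HasDerivAt.congr_deriv h3 ?_
  field_simp

lemma hasDeriv1_Is {ε : ℝ} (h0 : 0 < ε) {z : ℝ × ℝ} (hz : z ∈ box ε) (f : PA) :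
    HasDerivAt (fun s => evs ε (s, z.2) (Is ε f)) (evs ε z (Js ε f)) z.1 := by
  have hm := scaled_mem h0 hz.1 hz.2
  have h := hasDeriv1_I (z := (z.1 / ε, z.2 / ε ^ 2)) hm.1 hm.2 f
  have h2 : HasDerivAt (fun s : ℝ => s / ε) (1 / ε) z.1 := (hasDerivAt_id z.1).div_const _
  have h3 := (HasDerivAt.comp z.1 h h2).const_mul (ε ^ 2)
  simp only [evs, Is, Js, smul_apply, ev_smul']
  have hne := h0.ne'
  refine HasDerivAt.congr_deriv h3 ?_
  field_simp

lemma evs_zero_Is (ε : ℝ) (f : PA) : evs ε (0, 0) (Is ε f) = 0 := by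
  simp [evs, Is, ev_smul', ev_zero_I]

end PA

open Filter Topology

lemma fixed_point_family {E₁ E₂ : Type*} [NormedAddCommGroup E₁] [NormedSpace ℝ E₁]
    [CompleteSpace E₁] [NormedAddCommGroup E₂] [NormedSpace ℝ E₂] [CompleteSpace E₂]
    (G : E₁ × E₂ → E₂) (x0 : E₁) (U0 : E₂) (hG : ContDiffAt ℝ 1 G (x0, U0))
    (hc : ∀ U, G (x0, U) = U0) :
    ∃ ψ : E₁ → E₂, Tendsto ψ (𝓝 x0) (𝓝 U0) ∧ ∀ᶠ x in 𝓝 x0, G (x, ψ x) = ψ x := by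
  have hs := hG.hasStrictFDerivAt (by norm_num)
  have hF : HasStrictFDerivAt (fun w : E₁ × E₂ => w.2 - G w)
      (ContinuousLinearMap.snd ℝ E₁ E₂ - fderiv ℝ G (x0, U0)) (x0, U0) :=
    hasStrictFDerivAt_snd.sub hs
  have h0 : (fderiv ℝ G (x0, U0)) ∘L (ContinuousLinearMap.inr ℝ E₁ E₂) = 0 := by
    have h1 : HasFDerivAt (fun U : E₂ => G (x0, U))
        ((fderiv ℝ G (x0, U0)) ∘L (ContinuousLinearMap.inr ℝ E₁ E₂)) U0 :=
      HasFDerivAt.comp U0 (f := fun U : E₂ => (x0, U)) hs.hasFDerivAt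
        (hasFDerivAt_prodMk_right x0 U0)
    have h2 : HasFDerivAt (fun U : E₂ => G (x0, U)) (0 : E₂ →L[ℝ] E₂) U0 := by
      simp only [hc]
      exact hasFDerivAt_const _ _
    exact h1.unique h2
  have hinv : ((ContinuousLinearMap.snd ℝ E₁ E₂ - fderiv ℝ G (x0, U0)) ∘L
      (ContinuousLinearMap.inr ℝ E₁ E₂)).IsInvertible := by
    refine ⟨ContinuousLinearEquiv.refl ℝ E₂, ?_⟩
    rw [ContinuousLinearMap.sub_comp, h0]
    ext y
    simp
  refine ⟨hF.implicitFunctionOfProdDomain hinv, hF.tendsto_implicitFunctionOfProdDomain hinv, ?_⟩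
  filter_upwards [hF.eventually_apply_implicitFunctionOfProdDomain hinv] with x hx
  simp only [hc, sub_self] at hx
  exact (sub_eq_zero.mp hx).symm

section core
variable {A : Type*} [NormedCommRing A] [NormedAlgebra ℝ A]

/-- half of the curvature numerator not involving second derivatives -/
def Rterm (a b c a1 a2 b1 b2 c1 c2 : A) : A :=
  -a1 * ((2 * b2 - c1) * (2 * c) - 2 * b * c2)
    + (2 * b1 - a2) * ((2 * b2 - c1) * (2 * b) - 2 * a * c2)
    - (-a2 * (2 * c * a2 - 2 * b * c1) + c1 * (2 * b * a2 - 2 * a * c1))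

noncomputable def alphaHat (h q : A) (I J : A →L[ℝ] A) (Di k1 k2 k3 π α β γ : A) : A :=
  2 * J β - J (J γ) - I (h * ((1 + I α) * (1 + I γ) - (I β) * (I β)) *
    ((k3 + (1 + I (I π))) * (k1 + (1 + I (I π))) - k2 * k2)
    - q * (Rterm (1 + I α) (I β) (1 + I γ) (J α) α (J β) β (J γ) γ * Di))

noncomputable def betaHat (h : A) (I J : A →L[ℝ] A) (Li k1 k2 k3 k4 k5 π α β γ αh : A) : A :=
  Li * (h * ((k3 + (1 + I (I π))) * J γ) - k2 * αh - h * ((k1 + (1 + I (I π))) * J α)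
    - (1 + I α) * (k4 + J (I π)) + I β * (k5 - I π))

noncomputable def gammaHat (I J : A →L[ℝ] A) (Li k1 k2 k4 k5 π α β γ αh : A) : A :=
  Li * (- (2 * k2 * J γ) - (k1 + (1 + I (I π))) * (2 * J β - αh)
    + 2 * (-(I β * (k4 + J (I π))) + (1 + I γ) * (k5 - I π)))

variable {X : Type*} [NormedAddCommGroup X] [NormedSpace ℝ X] {x : X}

lemma contDiffAt_alphaHat (h q : A) (I J : X → A →L[ℝ] A) (Di k1 k2 k3 π α β γ : X → A)
    (hI : ContDiffAt ℝ 1 I x) (hJ : ContDiffAt ℝ 1 J x) (hDi : ContDiffAt ℝ 1 Di x)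
    (h1 : ContDiffAt ℝ 1 k1 x) (h2 : ContDiffAt ℝ 1 k2 x) (h3 : ContDiffAt ℝ 1 k3 x)
    (hπ : ContDiffAt ℝ 1 π x) (hα : ContDiffAt ℝ 1 α x) (hβ : ContDiffAt ℝ 1 β x)
    (hγ : ContDiffAt ℝ 1 γ x) :
    ContDiffAt ℝ 1 (fun y => alphaHat h q (I y) (J y) (Di y) (k1 y) (k2 y) (k3 y) (π y) (α y)
      (β y) (γ y)) x := by
  have e1 := hI.clm_apply hα
  have e2 := hI.clm_apply hβ
  have e3 := hI.clm_apply hγ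
  have e4 := hI.clm_apply (hI.clm_apply hπ)
  have e5 := hJ.clm_apply hα
  have e6 := hJ.clm_apply hβ
  have e7 := hJ.clm_apply hγ
  have e8 := hJ.clm_apply e7
  unfold alphaHat Rterm
  refine ((contDiffAt_const.mul e6).sub e8).sub (hI.clm_apply ?_)
  fun_prop

lemma contDiffAt_betaHat (h : A) (I J : X → A →L[ℝ] A) (Li k1 k2 k3 k4 k5 π α β γ αh : X → A)
    (hI : ContDiffAt ℝ 1 I x) (hJ : ContDiffAt ℝ 1 J x) (hLi : ContDiffAt ℝ 1 Li x)
    (h1 : ContDiffAt ℝ 1 k1 x) (h2 : ContDiffAt ℝ 1 k2 x) (h3 : ContDiffAt ℝ 1 k3 x)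
    (h4 : ContDiffAt ℝ 1 k4 x) (h5 : ContDiffAt ℝ 1 k5 x)
    (hπ : ContDiffAt ℝ 1 π x) (hα : ContDiffAt ℝ 1 α x) (hβ : ContDiffAt ℝ 1 β x)
    (hγ : ContDiffAt ℝ 1 γ x) (hαh : ContDiffAt ℝ 1 αh x) :
    ContDiffAt ℝ 1 (fun y => betaHat h (I y) (J y) (Li y) (k1 y) (k2 y) (k3 y) (k4 y) (k5 y)
      (π y) (α y) (β y) (γ y) (αh y)) x := by
  have e0 := hI.clm_apply hπ
  have e1 := hI.clm_apply hα
  have e2 := hI.clm_apply hβ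
  have e4 := hI.clm_apply e0
  have e5 := hJ.clm_apply hα
  have e7 := hJ.clm_apply hγ
  have e8 := hJ.clm_apply e0
  unfold betaHat
  fun_prop

lemma contDiffAt_gammaHat (I J : X → A →L[ℝ] A) (Li k1 k2 k4 k5 π α β γ αh : X → A)
    (hI : ContDiffAt ℝ 1 I x) (hJ : ContDiffAt ℝ 1 J x) (hLi : ContDiffAt ℝ 1 Li x)
    (h1 : ContDiffAt ℝ 1 k1 x) (h2 : ContDiffAt ℝ 1 k2 x)
    (h4 : ContDiffAt ℝ 1 k4 x) (h5 : ContDiffAt ℝ 1 k5 x)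
    (hπ : ContDiffAt ℝ 1 π x) (hα : ContDiffAt ℝ 1 α x) (hβ : ContDiffAt ℝ 1 β x)
    (hγ : ContDiffAt ℝ 1 γ x) (hαh : ContDiffAt ℝ 1 αh x) :
    ContDiffAt ℝ 1 (fun y => gammaHat (I y) (J y) (Li y) (k1 y) (k2 y) (k4 y) (k5 y)
      (π y) (α y) (β y) (γ y) (αh y)) x := by
  have e0 := hI.clm_apply hπ
  have e2 := hI.clm_apply hβ
  have e3 := hI.clm_apply hγ
  have e4 := hI.clm_apply e0
  have e6 := hJ.clm_apply hβ
  have e7 := hJ.clm_apply hγ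
  have e8 := hJ.clm_apply e0
  unfold gammaHat
  fun_prop
end core

section solve
variable {A : Type*} [NormedCommRing A] [NormedAlgebra ℝ A] [CompleteSpace A]

/-- the system of equations to be solved in the Banach algebra -/
def Solves (h q : A) (I J : A →L[ℝ] A) (k1 k2 k3 k4 k5 k6 π α β γ Li Di : A) : Prop :=
  (k3 + (1 + I (I π))) * Li = 1 ∧ ((1 + I α) * (1 + I γ) - I β * I β) * Di = 1 ∧
  π = - J (J π) - k6 ∧ α = alphaHat h q I J Di k1 k2 k3 π α β γ ∧
  β = betaHat h I J Li k1 k2 k3 k4 k5 π α β γ α ∧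
  γ = gammaHat I J Li k1 k2 k4 k5 π α β γ α

/-- parameter space -/
abbrev ParE (A : Type*) [NormedCommRing A] [NormedAlgebra ℝ A] : Type _ :=
  (A →L[ℝ] A) × (A →L[ℝ] A) × A × A × A × A × A × A

/-- space of unknowns -/
abbrev UnkE (A : Type*) : Type _ := A × A × A × A

lemma exists_solves (h q : A) (c1 c2 c3 c4 c5 c6 : A) (hu : IsUnit (c3 + 1))
    (I J : ℝ → A →L[ℝ] A) (k1 k2 k3 k4 k5 k6 : ℝ → A) (l : Filter ℝ)
    (hI : Tendsto I l (𝓝 0)) (hJ : Tendsto J l (𝓝 0))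
    (h1 : Tendsto k1 l (𝓝 c1)) (h2 : Tendsto k2 l (𝓝 c2)) (h3 : Tendsto k3 l (𝓝 c3))
    (h4 : Tendsto k4 l (𝓝 c4)) (h5 : Tendsto k5 l (𝓝 c5)) (h6 : Tendsto k6 l (𝓝 c6)) :
    ∀ᶠ ε in l, ∃ π α β γ Li Di : A, Solves h q (I ε) (J ε) (k1 ε) (k2 ε) (k3 ε) (k4 ε) (k5 ε)
      (k6 ε) π α β γ Li Di := by
  let Lf : ParE A × UnkE A → A := fun w => w.1.2.2.2.2.1 + (1 + w.1.1 (w.1.1 w.2.1))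
  let Df : ParE A × UnkE A → A := fun w =>
    (1 + w.1.1 w.2.2.1) * (1 + w.1.1 w.2.2.2.2) - w.1.1 w.2.2.2.1 * w.1.1 w.2.2.2.1
  let ah : ParE A × UnkE A → A := fun w => alphaHat h q w.1.1 w.1.2.1 (Ring.inverse (Df w)) w.1.2.2.1
    w.1.2.2.2.1 w.1.2.2.2.2.1 w.2.1 w.2.2.1 w.2.2.2.1 w.2.2.2.2
  let bh : ParE A × UnkE A → A := fun w => betaHat h w.1.1 w.1.2.1 (Ring.inverse (Lf w)) w.1.2.2.1
    w.1.2.2.2.1 w.1.2.2.2.2.1 w.1.2.2.2.2.2.1 w.1.2.2.2.2.2.2.1 w.2.1 w.2.2.1 w.2.2.2.1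
    w.2.2.2.2 (ah w)
  let gh : ParE A × UnkE A → A := fun w => gammaHat w.1.1 w.1.2.1 (Ring.inverse (Lf w)) w.1.2.2.1
    w.1.2.2.2.1 w.1.2.2.2.2.2.1 w.1.2.2.2.2.2.2.1 w.2.1 w.2.2.1 w.2.2.2.1 w.2.2.2.2 (ah w)
  let G : ParE A × UnkE A → UnkE A := fun w =>
    (- w.1.2.1 (w.1.2.1 w.2.1) - w.1.2.2.2.2.2.2.2, ah w, bh w, gh w)
  let x0 : ParE A := (0, 0, c1, c2, c3, c4, c5, c6)
  let U0 : UnkE A := G (x0, 0)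
  have pI : ContDiffAt ℝ 1 (fun w : ParE A × UnkE A => w.1.1) (x0, U0) := by fun_prop
  have pJ : ContDiffAt ℝ 1 (fun w : ParE A × UnkE A => w.1.2.1) (x0, U0) := by fun_prop
  have p1 : ContDiffAt ℝ 1 (fun w : ParE A × UnkE A => w.1.2.2.1) (x0, U0) := by fun_prop
  have p2 : ContDiffAt ℝ 1 (fun w : ParE A × UnkE A => w.1.2.2.2.1) (x0, U0) := by fun_prop
  have p3 : ContDiffAt ℝ 1 (fun w : ParE A × UnkE A => w.1.2.2.2.2.1) (x0, U0) := by fun_prop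
  have p4 : ContDiffAt ℝ 1 (fun w : ParE A × UnkE A => w.1.2.2.2.2.2.1) (x0, U0) := by fun_prop
  have p5 : ContDiffAt ℝ 1 (fun w : ParE A × UnkE A => w.1.2.2.2.2.2.2.1) (x0, U0) := by fun_prop
  have p6 : ContDiffAt ℝ 1 (fun w : ParE A × UnkE A => w.1.2.2.2.2.2.2.2) (x0, U0) := by fun_prop
  have pπ : ContDiffAt ℝ 1 (fun w : ParE A × UnkE A => w.2.1) (x0, U0) := by fun_prop
  have pα : ContDiffAt ℝ 1 (fun w : ParE A × UnkE A => w.2.2.1) (x0, U0) := by fun_prop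
  have pβ : ContDiffAt ℝ 1 (fun w : ParE A × UnkE A => w.2.2.2.1) (x0, U0) := by fun_prop
  have pγ : ContDiffAt ℝ 1 (fun w : ParE A × UnkE A => w.2.2.2.2) (x0, U0) := by fun_prop
  have hLf : ContDiffAt ℝ 1 Lf (x0, U0) :=
    p3.add (contDiffAt_const.add (pI.clm_apply (pI.clm_apply pπ)))
  have hDf : ContDiffAt ℝ 1 Df (x0, U0) :=
    ((contDiffAt_const.add (pI.clm_apply pα)).mul (contDiffAt_const.add (pI.clm_apply pγ))).sub
      ((pI.clm_apply pβ).mul (pI.clm_apply pβ))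
  have uL : IsUnit (Lf (x0, U0)) := by simpa [Lf, x0] using hu
  have uD : IsUnit (Df (x0, U0)) := by simp [Df, x0]
  have hLi : ContDiffAt ℝ 1 (fun w => Ring.inverse (Lf w)) (x0, U0) := by
    obtain ⟨y, hy⟩ := uL
    have := contDiffAt_ringInverse ℝ (n := 1) y
    rw [hy] at this
    exact this.comp (x0, U0) hLf
  have hDi : ContDiffAt ℝ 1 (fun w => Ring.inverse (Df w)) (x0, U0) := by
    obtain ⟨y, hy⟩ := uD
    have := contDiffAt_ringInverse ℝ (n := 1) y
    rw [hy] at this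
    exact this.comp (x0, U0) hDf
  have hah : ContDiffAt ℝ 1 ah (x0, U0) :=
    contDiffAt_alphaHat h q _ _ _ _ _ _ _ _ _ _ pI pJ hDi p1 p2 p3 pπ pα pβ pγ
  have hbh : ContDiffAt ℝ 1 bh (x0, U0) :=
    contDiffAt_betaHat h _ _ _ _ _ _ _ _ _ _ _ _ _ pI pJ hLi p1 p2 p3 p4 p5 pπ pα pβ pγ hah
  have hgh : ContDiffAt ℝ 1 gh (x0, U0) :=
    contDiffAt_gammaHat _ _ _ _ _ _ _ _ _ _ _ _ pI pJ hLi p1 p2 p4 p5 pπ pα pβ pγ hah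
  have hG : ContDiffAt ℝ 1 G (x0, U0) :=
    (((pJ.clm_apply (pJ.clm_apply pπ)).neg).sub p6).prodMk (hah.prodMk (hbh.prodMk hgh))
  have hc : ∀ U, G (x0, U) = U0 := by
    intro U
    simp [G, U0, x0, ah, bh, gh, Lf, Df, alphaHat, betaHat, gammaHat]
  obtain ⟨ψ, hψ, hfix⟩ := fixed_point_family G x0 U0 hG hc
  have hx : Tendsto (fun ε => ((I ε, J ε, k1 ε, k2 ε, k3 ε, k4 ε, k5 ε, k6 ε) : ParE A)) l (𝓝 x0) :=
    hI.prodMk_nhds (hJ.prodMk_nhds (h1.prodMk_nhds (h2.prodMk_nhds (h3.prodMk_nhds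
      (h4.prodMk_nhds (h5.prodMk_nhds h6))))))
  have hw : Tendsto (fun ε => (((I ε, J ε, k1 ε, k2 ε, k3 ε, k4 ε, k5 ε, k6 ε) : ParE A),
      ψ (I ε, J ε, k1 ε, k2 ε, k3 ε, k4 ε, k5 ε, k6 ε))) l (𝓝 (x0, U0)) :=
    hx.prodMk_nhds (hψ.comp hx)
  have eL : ∀ᶠ w in 𝓝 (x0, U0), IsUnit (Lf w) :=
    hLf.continuousAt.eventually (Units.isOpen.mem_nhds uL)
  have eD : ∀ᶠ w in 𝓝 (x0, U0), IsUnit (Df w) :=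
    hDf.continuousAt.eventually (Units.isOpen.mem_nhds uD)
  filter_upwards [hx.eventually hfix, hw.eventually eL, hw.eventually eD] with ε g1 g2 g3
  set x : ParE A := (I ε, J ε, k1 ε, k2 ε, k3 ε, k4 ε, k5 ε, k6 ε)
  have a1 : - J ε (J ε (ψ x).1) - k6 ε = (ψ x).1 := congrArg Prod.fst g1
  have a2 : ah (x, ψ x) = (ψ x).2.1 := congrArg (fun y => y.2.1) g1
  have a3 : bh (x, ψ x) = (ψ x).2.2.1 := congrArg (fun y => y.2.2.1) g1
  have a4 : gh (x, ψ x) = (ψ x).2.2.2 := congrArg (fun y => y.2.2.2) g1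
  refine ⟨(ψ x).1, (ψ x).2.1, (ψ x).2.2.1, (ψ x).2.2.2, Ring.inverse (Lf (x, ψ x)),
    Ring.inverse (Df (x, ψ x)), Ring.mul_inverse_cancel _ g2, Ring.mul_inverse_cancel _ g3,
    a1.symm, a2.symm, ?_, ?_⟩
  · simp only [bh, a2] at a3
    exact a3.symm
  · simp only [gh, a2] at a4
    exact a4.symm
end solve

open Filter Topology

lemma hasDerivAt_sd1 {f : ℝ × ℝ → ℝ} {x : ℝ × ℝ} (hf : DifferentiableAt ℝ f x) :
    HasDerivAt (fun s => f (s, x.2)) (fderiv ℝ f x (1, 0)) x.1 := by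
  have h1 : HasDerivAt (fun s : ℝ => (s, x.2)) ((1 : ℝ), (0 : ℝ)) x.1 :=
    (hasDerivAt_id x.1).prodMk (hasDerivAt_const x.1 x.2)
  exact HasFDerivAt.comp_hasDerivAt x.1 (f := fun s : ℝ => (s, x.2)) hf.hasFDerivAt h1

lemma hasDerivAt_sd2 {f : ℝ × ℝ → ℝ} {x : ℝ × ℝ} (hf : DifferentiableAt ℝ f x) :
    HasDerivAt (fun s => f (x.1, s)) (fderiv ℝ f x (0, 1)) x.2 := by
  have h1 : HasDerivAt (fun s : ℝ => (x.1, s)) ((0 : ℝ), (1 : ℝ)) x.2 :=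
    (hasDerivAt_const x.2 x.1).prodMk (hasDerivAt_id x.2)
  exact HasFDerivAt.comp_hasDerivAt x.2 (f := fun s : ℝ => (x.1, s)) hf.hasFDerivAt h1

lemma sd1_eq {f : ℝ × ℝ → ℝ} {x : ℝ × ℝ} (hf : DifferentiableAt ℝ f x) :
    sd1 f x = fderiv ℝ f x (1, 0) := (hasDerivAt_sd1 hf).deriv

lemma sd2_eq {f : ℝ × ℝ → ℝ} {x : ℝ × ℝ} (hf : DifferentiableAt ℝ f x) :
    sd2 f x = fderiv ℝ f x (0, 1) := (hasDerivAt_sd2 hf).deriv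

lemma sd1_congr {f g : ℝ × ℝ → ℝ} {x : ℝ × ℝ} (h : f =ᶠ[𝓝 x] g) : sd1 f x = sd1 g x := by
  apply Filter.EventuallyEq.deriv_eq
  have : Tendsto (fun s : ℝ => (s, x.2)) (𝓝 x.1) (𝓝 x) := by
    have hc : Continuous (fun s : ℝ => (s, x.2)) := by fun_prop
    exact hc.tendsto x.1
  exact this.eventually h

lemma sd2_congr {f g : ℝ × ℝ → ℝ} {x : ℝ × ℝ} (h : f =ᶠ[𝓝 x] g) : sd2 f x = sd2 g x := by
  apply Filter.EventuallyEq.deriv_eq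
  have : Tendsto (fun s : ℝ => (x.1, s)) (𝓝 x.2) (𝓝 x) := by
    have hc : Continuous (fun s : ℝ => (x.1, s)) := by fun_prop
    exact hc.tendsto x.2
  exact this.eventually h

lemma sd1_congrOn {f g : ℝ × ℝ → ℝ} {S : Set (ℝ × ℝ)} (hS : IsOpen S) (h : ∀ y ∈ S, f y = g y)
    {x : ℝ × ℝ} (hx : x ∈ S) : sd1 f x = sd1 g x :=
  sd1_congr (Filter.eventually_of_mem (hS.mem_nhds hx) h)

lemma sd2_congrOn {f g : ℝ × ℝ → ℝ} {S : Set (ℝ × ℝ)} (hS : IsOpen S) (h : ∀ y ∈ S, f y = g y)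
    {x : ℝ × ℝ} (hx : x ∈ S) : sd2 f x = sd2 g x :=
  sd2_congr (Filter.eventually_of_mem (hS.mem_nhds hx) h)

lemma analytic_sd1 {f : ℝ × ℝ → ℝ} {S : Set (ℝ × ℝ)} (hS : IsOpen S) (hf : AnalyticOnNhd ℝ f S) :
    AnalyticOnNhd ℝ (sd1 f) S := by
  intro x hx
  have h1 : AnalyticAt ℝ (fun y => fderiv ℝ f y (1, 0)) x :=
    ((ContinuousLinearMap.apply ℝ ℝ ((1 : ℝ), (0 : ℝ))).analyticAt _).comp (hf.fderiv x hx)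
  refine h1.congr ?_
  filter_upwards [hS.mem_nhds hx] with y hy
  exact (sd1_eq (hf y hy).differentiableAt).symm

lemma analytic_sd2 {f : ℝ × ℝ → ℝ} {S : Set (ℝ × ℝ)} (hS : IsOpen S) (hf : AnalyticOnNhd ℝ f S) :
    AnalyticOnNhd ℝ (sd2 f) S := by
  intro x hx
  have h1 : AnalyticAt ℝ (fun y => fderiv ℝ f y (0, 1)) x :=
    ((ContinuousLinearMap.apply ℝ ℝ ((0 : ℝ), (1 : ℝ))).analyticAt _).comp (hf.fderiv x hx)
  refine h1.congr ?_
  filter_upwards [hS.mem_nhds hx] with y hy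
  exact (sd2_eq (hf y hy).differentiableAt).symm

lemma sd_comm {f : ℝ × ℝ → ℝ} {S : Set (ℝ × ℝ)} (hS : IsOpen S) (hf : AnalyticOnNhd ℝ f S)
    {x : ℝ × ℝ} (hx : x ∈ S) : sd1 (sd2 f) x = sd2 (sd1 f) x := by
  have hd : DifferentiableAt ℝ (fderiv ℝ f) x := (hf.fderiv x hx).differentiableAt
  have e2 : sd1 (sd2 f) x = sd1 (fun y => fderiv ℝ f y (0, 1)) x :=
    sd1_congrOn hS (fun y hy => sd2_eq (hf y hy).differentiableAt) hx
  have e1 : sd2 (sd1 f) x = sd2 (fun y => fderiv ℝ f y (1, 0)) x :=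
    sd2_congrOn hS (fun y hy => sd1_eq (hf y hy).differentiableAt) hx
  rw [e1, e2, sd1_eq (by fun_prop), sd2_eq (by fun_prop)]
  have hsym : IsSymmSndFDerivAt ℝ f x :=
    (hf x hx).contDiffAt (n := 2) |>.isSymmSndFDerivAt (by simp)
  rw [fderiv_clm_apply hd (by fun_prop), fderiv_clm_apply hd (by fun_prop)]
  simp
  exact hsym _ _

namespace PA

lemma sd2_Is {ε : ℝ} (h0 : 0 < ε) {z : ℝ × ℝ} (hz : z ∈ box ε) (f : PA) :
    sd2 (fun y => evs ε y (Is ε f)) z = evs ε z f := (hasDeriv2_Is h0 hz f).deriv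

lemma sd1_Is {ε : ℝ} (h0 : 0 < ε) {z : ℝ × ℝ} (hz : z ∈ box ε) (f : PA) :
    sd1 (fun y => evs ε y (Is ε f)) z = evs ε z (Js ε f) := (hasDeriv1_Is h0 hz f).deriv

lemma sd2_Js {ε : ℝ} (h0 : 0 < ε) {z : ℝ × ℝ} (hz : z ∈ box ε) (f : PA) :
    sd2 (fun y => evs ε y (Js ε f)) z = sd1 (fun y => evs ε y f) z := by
  rw [← sd2_congrOn (isOpen_sbox ε) (fun y hy => sd1_Is h0 hy f) hz,
    ← sd1_congrOn (isOpen_sbox ε) (fun y hy => sd2_Is h0 hy f) hz]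
  exact (sd_comm (isOpen_sbox ε) (evs_analytic h0 _) hz).symm

lemma sd2_alpha {ε : ℝ} (h0 : 0 < ε) {z : ℝ × ℝ} (hz : z ∈ box ε) (α β γ Y : PA)
    (h : α = 2 * Js ε β - Js ε (Js ε γ) - Is ε Y) :
    sd2 (fun y => evs ε y α) z =
      2 * sd1 (fun y => evs ε y β) z - sd1 (fun y => evs ε y (Js ε γ)) z - evs ε z Y := by
  have e : ∀ y ∈ box ε, evs ε y α =
      2 * evs ε y (Js ε β) - evs ε y (Js ε (Js ε γ)) - evs ε y (Is ε Y) := by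
    intro y hy
    simp only [← evsHom_apply h0 hy]
    conv_lhs => rw [h]
    rw [map_sub, map_sub, map_mul, map_ofNat]
  rw [sd2_congrOn (isOpen_sbox ε) e hz, ← sd2_Js h0 hz, ← sd2_Js h0 hz, ← sd2_Is h0 hz Y]
  have d : ∀ f : PA, HasDerivAt (fun s => evs ε (z.1, s) f) (sd2 (fun y => evs ε y f) z) z.2 := by
    intro f
    have := (evs_analytic h0 f z hz).differentiableAt
    rw [sd2_eq this]
    exact hasDerivAt_sd2 this
  exact ((((d (Js ε β)).const_mul 2).sub (d (Js ε (Js ε γ)))).sub (d (Is ε Y))).deriv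

end PA

lemma final_algebra {a b c a1 a2 b1 b2 c1 c2 L M N A B X Li Di : ℝ}
    (hL : L * Li = 1) (hD : (a * c - b * b) * Di = 1)
    (hX : X = 1 / 2 * (a * c - b * b) * (L * N - M * M)
      - 1 / 4 * (Rterm a b c a1 a2 b1 b2 c1 c2 * Di))
    (hb : b2 = Li * (1 / 2 * (L * c1) + M * a2 - 1 / 2 * (N * a1) - a * A + b * B))
    (hc : c2 = Li * (2 * M * c1 - N * (2 * b1 - a2) + 2 * (-(b * A) + c * B))) :
    (A = -((c * (2 * b2 - c1) - b * c2) / (2 * (a * c - b ^ 2))) * L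
        + 2 * ((c * a2 - b * c1) / (2 * (a * c - b ^ 2))) * M
        - (c * a1 - b * (2 * b1 - a2)) / (2 * (a * c - b ^ 2)) * N) ∧
    (B = (-b * (2 * b2 - c1) + a * c2) / (2 * (a * c - b ^ 2)) * L
        - 2 * ((-b * a2 + a * c1) / (2 * (a * c - b ^ 2))) * M
        + (-b * a1 + a * (2 * b1 - a2)) / (2 * (a * c - b ^ 2)) * N) ∧
    L * N - M ^ 2 = (1 / (2 * (a * c - b ^ 2) ^ 2)) * Matrix.det !![X, a1, 2 * b1 - a2;
                  2 * b2 - c1, 2 * a, 2 * b; c2, 2 * b, 2 * c]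
      - (1 / (2 * (a * c - b ^ 2) ^ 2)) * Matrix.det !![0, a2, c1;
                  a2, 2 * a, 2 * b; c1, 2 * b, 2 * c] := by
  have hb' : L * b2 = 1 / 2 * (L * c1) + M * a2 - 1 / 2 * (N * a1) - a * A + b * B := by
    rw [hb, ← mul_assoc, hL, one_mul]
  have hc' : L * c2 = 2 * M * c1 - N * (2 * b1 - a2) + 2 * (-(b * A) + c * B) := by
    rw [hc, ← mul_assoc, hL, one_mul]
  have hbb : a * c - b * b = a * c - b ^ 2 := by ring
  rw [hbb] at hD hX
  have hD0 : a * c - b ^ 2 ≠ 0 := left_ne_zero_of_mul_eq_one hD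
  have hDi : Di = 1 / (a * c - b ^ 2) := by
    rw [eq_div_iff hD0, mul_comm]; exact hD
  refine ⟨?_, ?_, ?_⟩
  · obtain ⟨D, hDD⟩ : ∃ D, D = a * c - b ^ 2 := ⟨_, rfl⟩
    rw [← hDD] at hD0 ⊢
    field_simp
    linear_combination (2 * c) * hb' - b * hc' + 2 * A * hDD
  · field_simp
    linear_combination (2 * b) * hb' - a * hc'
  · rw [Matrix.det_fin_three, Matrix.det_fin_three, hX, hDi]
    simp [Rterm]
    field_simp
    ring

open Filter Topology

/-- Lemma 4.1: given an analytic divergence-free velocity `(u, v)` near the origin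
with `u(0,0)v(0,0) ≠ 0`, there are locally analytic `p > 0` and a metric `g`
(normalized to the identity at the origin) solving the initial data system:
the pressure Poisson equation and the Gauss–Codazzi equations with
`L = v² + p`, `M = −uv`, `N = u² + p`. -/
theorem statement3 (S : Set (ℝ × ℝ)) (hS : IsOpen S) (hS0 : ((0 : ℝ), (0 : ℝ)) ∈ S)
    (u v : ℝ × ℝ → ℝ) (hu : AnalyticOnNhd ℝ u S) (hv : AnalyticOnNhd ℝ v S)
    (hdiv : ∀ x ∈ S, sd1 u x + sd2 v x = 0)
    (hne : u (0, 0) * v (0, 0) ≠ 0) :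
    ∃ W : Set (ℝ × ℝ), IsOpen W ∧ ((0 : ℝ), (0 : ℝ)) ∈ W ∧ W ⊆ S ∧
    ∃ p g11 g12 g22 : ℝ × ℝ → ℝ,
      AnalyticOnNhd ℝ p W ∧ AnalyticOnNhd ℝ g11 W ∧ AnalyticOnNhd ℝ g12 W ∧
      AnalyticOnNhd ℝ g22 W ∧
      (∀ x ∈ W, 0 < p x) ∧
      g11 (0, 0) = 1 ∧ g22 (0, 0) = 1 ∧ g12 (0, 0) = 0 ∧
      (∀ x ∈ W, 0 < sdetg g11 g12 g22 x) ∧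
      (∀ x ∈ W,
        sd1 (sd1 (fun y => (u y) ^ 2)) x + 2 * sd1 (sd2 (fun y => u y * v y)) x
          + sd2 (sd2 (fun y => (v y) ^ 2)) x
        = -(sd1 (sd1 p) x + sd2 (sd2 p) x)) ∧
      (∀ x ∈ W,
        SGaussCodazzi (fun y => (v y) ^ 2 + p y) (fun y => -(u y * v y))
          (fun y => (u y) ^ 2 + p y) g11 g12 g22 x) := by
  have h0S : (0 : ℝ × ℝ) ∈ S := hS0
  have a1 : AnalyticOnNhd ℝ (fun y => (u y) ^ 2) S := hu.pow 2
  have a2 : AnalyticOnNhd ℝ (fun y => u y * v y) S := hu.mul hv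
  have a3 : AnalyticOnNhd ℝ (fun y => (v y) ^ 2) S := hv.pow 2
  have a4 : AnalyticOnNhd ℝ
      (fun y => sd1 (fun y => (u y) ^ 2) y + sd2 (fun y => u y * v y) y) S :=
    (analytic_sd1 hS a1).add (analytic_sd2 hS a2)
  have a5 : AnalyticOnNhd ℝ
      (fun y => -sd1 (fun y => u y * v y) y - sd2 (fun y => (v y) ^ 2) y) S :=
    (analytic_sd1 hS a2).neg.sub (analytic_sd2 hS a3)
  have a6 : AnalyticOnNhd ℝ
      (fun x => sd1 (sd1 (fun y => (u y) ^ 2)) x + 2 * sd1 (sd2 (fun y => u y * v y)) x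
          + sd2 (sd2 (fun y => (v y) ^ 2)) x) S :=
    ((analytic_sd1 hS (analytic_sd1 hS a1)).add
      (analyticOnNhd_const.mul (analytic_sd1 hS (analytic_sd2 hS a2)))).add
      (analytic_sd2 hS (analytic_sd2 hS a3))
  obtain ⟨k1, t1, e1⟩ := PA.embed (a1 0 h0S)
  obtain ⟨k2, t2, e2⟩ := PA.embed (a2 0 h0S)
  obtain ⟨k3, t3, e3⟩ := PA.embed (a3 0 h0S)
  obtain ⟨k4, t4, e4⟩ := PA.embed (a4 0 h0S)
  obtain ⟨k5, t5, e5⟩ := PA.embed (a5 0 h0S)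
  obtain ⟨k6, t6, e6⟩ := PA.embed (a6 0 h0S)
  have hunit : IsUnit (algebraMap ℝ PA ((v 0) ^ 2) + 1) := by
    rw [← map_one (algebraMap ℝ PA), ← map_add]
    apply IsUnit.map
    have : (v 0) ^ 2 + 1 ≠ 0 := by positivity
    exact this.isUnit
  have hsol := exists_solves (algebraMap ℝ PA (1 / 2)) (algebraMap ℝ PA (1 / 4)) _ _ _ _ _ _
    hunit PA.Is PA.Js k1 k2 k3 k4 k5 k6 (𝓝[>] 0) PA.Is_tendsto PA.Js_tendsto t1 t2 t3 t4 t5 t6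
  have hpos : ∀ᶠ ε in 𝓝[>] (0 : ℝ), 0 < ε := self_mem_nhdsWithin
  obtain ⟨ε, hε, ⟨π, α, β, γ, Li, Di, s1, s2, s3, s4, s5, s6⟩, f1, f2, f3, f4, f5, f6⟩ :=
    (hpos.and (hsol.and (e1.and (e2.and (e3.and (e4.and (e5.and e6))))))).exists
  clear hsol e1 e2 e3 e4 e5 e6 t1 t2 t3 t4 t5 t6 hpos hunit
  -- the solution functions
  let p : ℝ × ℝ → ℝ := fun y => 1 + PA.evs ε y (PA.Is ε (PA.Is ε π))
  let ga : ℝ × ℝ → ℝ := fun y => 1 + PA.evs ε y (PA.Is ε α)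
  let gb : ℝ × ℝ → ℝ := fun y => PA.evs ε y (PA.Is ε β)
  let gc : ℝ × ℝ → ℝ := fun y => 1 + PA.evs ε y (PA.Is ε γ)
  have hB := PA.isOpen_sbox ε
  have hp : AnalyticOnNhd ℝ p (PA.box ε) := analyticOnNhd_const.add (PA.evs_analytic hε _)
  have hga : AnalyticOnNhd ℝ ga (PA.box ε) := analyticOnNhd_const.add (PA.evs_analytic hε _)
  have hgb : AnalyticOnNhd ℝ gb (PA.box ε) := PA.evs_analytic hε _
  have hgc : AnalyticOnNhd ℝ gc (PA.box ε) := analyticOnNhd_const.add (PA.evs_analytic hε _)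
  have hdet : ContinuousOn (sdetg ga gb gc) (PA.box ε) :=
    (hga.continuousOn.mul hgc.continuousOn).sub (hgb.continuousOn.pow 2)
  have p0 : p (0, 0) = 1 := by simp [p, PA.evs_zero_Is]
  have ga0 : ga (0, 0) = 1 := by simp [ga, PA.evs_zero_Is]
  have gb0 : gb (0, 0) = 0 := by simp [gb, PA.evs_zero_Is]
  have gc0 : gc (0, 0) = 1 := by simp [gc, PA.evs_zero_Is]
  have hO1 : IsOpen (PA.box ε ∩ p ⁻¹' Set.Ioi 0) :=
    hp.continuousOn.isOpen_inter_preimage hB isOpen_Ioi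
  have hO2 : IsOpen (PA.box ε ∩ sdetg ga gb gc ⁻¹' Set.Ioi 0) :=
    hdet.isOpen_inter_preimage hB isOpen_Ioi
  have h0B : ((0 : ℝ), (0 : ℝ)) ∈ PA.box ε := by
    constructor <;> simp only [abs_zero] <;> positivity
  -- first derivatives on the box
  have p1 : ∀ y ∈ PA.box ε, sd1 p y = PA.evs ε y (PA.Is ε (PA.Js ε π)) := by
    intro y hy
    rw [PA.Is_Js_comm, ← PA.sd1_Is hε hy]
    exact deriv_const_add _
  have p2 : ∀ y ∈ PA.box ε, sd2 p y = PA.evs ε y (PA.Is ε π) := by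
    intro y hy
    rw [← PA.sd2_Is hε hy]
    exact deriv_const_add _
  have ga1 : ∀ y ∈ PA.box ε, sd1 ga y = PA.evs ε y (PA.Js ε α) := by
    intro y hy
    rw [← PA.sd1_Is hε hy]
    exact deriv_const_add _
  have ga2 : ∀ y ∈ PA.box ε, sd2 ga y = PA.evs ε y α := by
    intro y hy
    rw [← PA.sd2_Is hε hy]
    exact deriv_const_add _
  have gb1 : ∀ y ∈ PA.box ε, sd1 gb y = PA.evs ε y (PA.Js ε β) :=
    fun y hy => PA.sd1_Is hε hy _
  have gb2 : ∀ y ∈ PA.box ε, sd2 gb y = PA.evs ε y β :=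
    fun y hy => PA.sd2_Is hε hy _
  have gc1 : ∀ y ∈ PA.box ε, sd1 gc y = PA.evs ε y (PA.Js ε γ) := by
    intro y hy
    rw [← PA.sd1_Is hε hy]
    exact deriv_const_add _
  have gc2 : ∀ y ∈ PA.box ε, sd2 gc y = PA.evs ε y γ := by
    intro y hy
    rw [← PA.sd2_Is hε hy]
    exact deriv_const_add _
  refine ⟨S ∩ ((PA.box ε ∩ p ⁻¹' Set.Ioi 0) ∩ (PA.box ε ∩ sdetg ga gb gc ⁻¹' Set.Ioi 0)),
    hS.inter (hO1.inter hO2), ⟨hS0, ⟨h0B, ?_⟩, ⟨h0B, ?_⟩⟩, Set.inter_subset_left,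
    p, ga, gb, gc, hp.mono ?_, hga.mono ?_, hgb.mono ?_, hgc.mono ?_, fun x hx => hx.2.1.2,
    ga0, gc0, gb0, fun x hx => hx.2.2.2, ?_, ?_⟩
  · simp only [Set.mem_preimage, p0]
    exact Set.mem_Ioi.mpr (one_pos : (0 : ℝ) < 1)
  · simp only [Set.mem_preimage, sdetg, ga0, gb0, gc0]
    norm_num
  · exact fun x hx => hx.2.1.1
  · exact fun x hx => hx.2.1.1
  · exact fun x hx => hx.2.1.1
  · exact fun x hx => hx.2.1.1
  · intro x hx
    have hb : x ∈ PA.box ε := hx.2.1.1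
    rw [sd1_congrOn hB p1 hb, sd2_congrOn hB p2 hb, PA.sd1_Is hε hb, PA.sd2_Is hε hb,
      ← f6 x hb.1 hb.2]
    have := congrArg (PA.evsHom hε hb) s3
    simp only [map_sub, map_neg, PA.evsHom_apply] at this
    linarith
  · intro x hx
    have hb : x ∈ PA.box ε := hx.2.1.1
    have hxS : x ∈ S := hx.1
    have g1 := f1 x hb.1 hb.2
    have g2 := f2 x hb.1 hb.2
    have g3 := f3 x hb.1 hb.2
    have g4 := f4 x hb.1 hb.2
    have g5 := f5 x hb.1 hb.2
    -- derivatives of L, M, N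
    have dN1 : sd1 (fun y => (u y) ^ 2 + p y) x = sd1 (fun y => (u y) ^ 2) x + sd1 p x := by
      have q1 := (a1 x hxS).differentiableAt
      have q2 := (hp x hb).differentiableAt
      rw [sd1_eq q1, sd1_eq q2]
      exact ((hasDerivAt_sd1 q1).add (hasDerivAt_sd1 q2)).deriv
    have dL2 : sd2 (fun y => (v y) ^ 2 + p y) x = sd2 (fun y => (v y) ^ 2) x + sd2 p x := by
      have q1 := (a3 x hxS).differentiableAt
      have q2 := (hp x hb).differentiableAt
      rw [sd2_eq q1, sd2_eq q2]
      exact ((hasDerivAt_sd2 q1).add (hasDerivAt_sd2 q2)).deriv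
    have dM1 : sd1 (fun y => -(u y * v y)) x = -sd1 (fun y => u y * v y) x := deriv.fun_neg
    have dM2 : sd2 (fun y => -(u y * v y)) x = -sd2 (fun y => u y * v y) x := deriv.fun_neg
    -- second derivatives of the metric
    have s4' := s4
    unfold alphaHat at s4'
    have hX' := PA.sd2_alpha hε hb _ _ _ _ s4'
    rw [← sd2_congrOn hB ga2 hb, ← sd1_congrOn hB gb2 hb, ← sd1_congrOn hB gc1 hb,
      ← PA.evsHom_apply hε hb] at hX'
    have r1 := congrArg (PA.evsHom hε hb) s1
    have r2 := congrArg (PA.evsHom hε hb) s2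
    have r5 := congrArg (PA.evsHom hε hb) s5
    have r6 := congrArg (PA.evsHom hε hb) s6
    simp only [betaHat, gammaHat, Rterm, map_add, map_sub, map_mul, map_neg, map_one, map_ofNat,
      AlgHom.commutes, Algebra.algebraMap_self, RingHom.id_apply] at r1 r2 r5 r6 hX'
    simp only [PA.evsHom_apply, g1, g2, g3, g4, g5] at r1 r2 r5 r6 hX'
    have fa := final_algebra (a := ga x) (b := gb x) (c := gc x) (a1 := sd1 ga x)
      (a2 := sd2 ga x) (b1 := sd1 gb x) (b2 := sd2 gb x) (c1 := sd1 gc x) (c2 := sd2 gc x)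
      (L := (v x) ^ 2 + p x) (M := -(u x * v x)) (N := (u x) ^ 2 + p x)
      (A := sd1 (fun y => (u y) ^ 2 + p y) x - sd2 (fun y => -(u y * v y)) x)
      (B := sd1 (fun y => -(u y * v y)) x - sd2 (fun y => (v y) ^ 2 + p y) x)
      (Li := PA.evs ε x Li) (Di := PA.evs ε x Di) r1 r2
      (X := -(sd2 (sd2 ga) x) + 2 * sd1 (sd2 gb) x - sd1 (sd1 gc) x)
      (by
        rw [ga1 x hb, ga2 x hb, gb1 x hb, gb2 x hb, gc1 x hb, gc2 x hb]
        simp only [ga, gb, gc, p, Rterm] at hX' ⊢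
        linear_combination -hX')
      (by
        rw [dN1, dL2, dM1, dM2, p1 x hb, p2 x hb, PA.Is_Js_comm, ga1 x hb, ga2 x hb, gb2 x hb,
          gc1 x hb]
        simp only [ga, gb, p]
        rw [r5]
        ring)
      (by
        rw [dN1, dL2, dM1, dM2, p1 x hb, p2 x hb, PA.Is_Js_comm, ga2 x hb, gb1 x hb,
          gc1 x hb, gc2 x hb]
        simp only [gb, gc, p]
        rw [r6]
        ring)
    exact fa
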